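/- arXiv:1307.3693 — 2 statements merged into one kernel-verified Lean document; each statement's English description precedes it below -/
import Mathlib

section
/- For any γ > 0 there exists an integer n₀ such that the following holds. Suppose H is a 3-graph on n > n₀ vertices with δ₁(H) ≥ (7/16 − γ)·C(n,2). Then either there is a 𝒴-tiling in H covering all but at most 2¹⁹/γ vertices of H, or H is 2¹⁰γ-extremal. -/
/-- The degree of a vertex in a 3-graph: the number of edges containing it. -/
def hdeg {α : Type*} [DecidableEq α] (H : Finset (Finset α)) (v : α) : ℕ :=
  (H.filter (fun e => v ∈ e)).card

/-- The number of edges of `H` contained in the vertex set `B`. -/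
def eIn {α : Type*} [DecidableEq α] (H : Finset (Finset α)) (B : Finset α) : ℕ :=
  (H.filter (fun e => e ⊆ B)).card

/-- A 3-graph on `n` vertices is `β`-extremal if some vertex set `B` of size `⌊3n/4⌋`
spans at most `β n³` edges. -/
def BetaExtremal (β : ℝ) (n : ℕ) (H : Finset (Finset (Fin n))) : Prop :=
  ∃ B : Finset (Fin n), B.card = 3 * n / 4 ∧ (eIn H B : ℝ) ≤ β * (n : ℝ) ^ 3

/-- `f` enumerates a `𝒴`-tiling of `H` with `m` members: the `4m` vertices
`f i j` (`i : Fin m`, `j : Fin 4`) are distinct and for each `i` the quadruple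
`f i 0, f i 1, f i 2, f i 3` spans a copy of `𝒴` (edges `{f i 0, f i 1, f i 2}` and
`{f i 1, f i 2, f i 3}`). -/
def IsYTiling {α : Type*} [DecidableEq α] (H : Finset (Finset α)) (m : ℕ)
    (f : Fin m → Fin 4 → α) : Prop :=
  Function.Injective (fun p : Fin m × Fin 4 => f p.1 p.2) ∧
  ∀ i : Fin m, ({f i 0, f i 1, f i 2} : Finset α) ∈ H ∧
    ({f i 1, f i 2, f i 3} : Finset α) ∈ H

namespace YTiling

variable {α : Type*} [DecidableEq α]

section Bipartite

variable {β : Type*}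

/-- A bipartite relation without a matching of size three has a vertex cover of size two. -/
theorem exists_cover_of_no_three_matching {h : α → β → Prop}
    (hno : ∀ a₁ a₂ a₃ b₁ b₂ b₃, h a₁ b₁ → h a₂ b₂ → h a₃ b₃ →
      a₁ = a₂ ∨ a₁ = a₃ ∨ a₂ = a₃ ∨ b₁ = b₂ ∨ b₁ = b₃ ∨ b₂ = b₃)
    {a₀ : α} {b₀ : β} (h₀ : h a₀ b₀) :
    (∃ x x', ∀ a b, h a b → a = x ∨ a = x') ∨ (∃ y y', ∀ a b, h a b → b = y ∨ b = y') ∨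
      ∃ x y, ∀ a b, h a b → a = x ∨ b = y := by
  by_cases h2 : ∃ x₁ y₁ x₂ y₂, h x₁ y₁ ∧ h x₂ y₂ ∧ x₁ ≠ x₂ ∧ y₁ ≠ y₂
  · obtain ⟨x₁, y₁, x₂, y₂, h11, h22, hx, hy⟩ := h2
    by_cases P1 : ∃ y, y ≠ y₁ ∧ y ≠ y₂ ∧ h x₁ y <;> by_cases P2 : ∃ y, y ≠ y₁ ∧ y ≠ y₂ ∧ h x₂ y
    · left
      refine ⟨x₁, x₂, fun a b hab => ?_⟩
      grind
    · by_cases Q2 : ∃ x, x ≠ x₁ ∧ x ≠ x₂ ∧ h x y₂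
      · right; right
        refine ⟨x₁, y₂, fun a b hab => ?_⟩
        grind
      · left
        refine ⟨x₁, x₂, fun a b hab => ?_⟩
        grind
    · by_cases Q1 : ∃ x, x ≠ x₁ ∧ x ≠ x₂ ∧ h x y₁
      · right; right
        refine ⟨x₂, y₁, fun a b hab => ?_⟩
        grind
      · left
        refine ⟨x₁, x₂, fun a b hab => ?_⟩
        grind
    · right; left
      refine ⟨y₁, y₂, fun a b hab => ?_⟩
      by_contra hc
      rw [not_or] at hc
      by_cases ha : a = x₁
      · exact P1 ⟨b, hc.1, hc.2, ha ▸ hab⟩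
      by_cases ha' : a = x₂
      · exact P2 ⟨b, hc.1, hc.2, ha' ▸ hab⟩
      grind
  · right; right
    refine ⟨a₀, b₀, fun a b hab => ?_⟩
    by_contra hc
    rw [not_or] at hc
    exact h2 ⟨a, b, a₀, b₀, hab, h₀, hc.1, hc.2⟩

/-- Any two vertices of `t` can be matched, in some order, to the same two vertices of `s`. -/
def Dominates (h : α → β → Prop) (s : Finset α) (t : Finset β) : Prop :=
  ∃ x ∈ s, ∃ x' ∈ s, x ≠ x' ∧ ∀ y ∈ t, ∀ y' ∈ t, y ≠ y' → (h x y ∧ h x' y') ∨ (h x y' ∧ h x' y)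

/-- `h` contains the double star on `s` and `t` with centres `x` and `y`. -/
def IsCenter (h : α → β → Prop) (s : Finset α) (t : Finset β) (x : α) (y : β) : Prop :=
  x ∈ s ∧ y ∈ t ∧ ∀ a ∈ s, ∀ b ∈ t, a = x ∨ b = y → h a b

theorem dominates_of_cover [DecidableEq β] {h : α → β → Prop} [∀ a b, Decidable (h a b)]
    {s : Finset α} {t : Finset β} (ht : t.card = 4)
    (hE : 7 ≤ ((s ×ˢ t).filter fun e => h e.1 e.2).card) {x x' : α}
    (hc : ∀ a ∈ s, ∀ b ∈ t, h a b → a = x ∨ a = x') :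
    Dominates h s t ∧ ((s ×ˢ t).filter fun e => h e.1 e.2).card ≤ 8 := by
  set E := (s ×ˢ t).filter fun e => h e.1 e.2 with hEdef
  have hmem : ∀ a b, (a, b) ∈ E ↔ (a ∈ s ∧ b ∈ t) ∧ h a b := by simp [hEdef]
  have hsub : E ⊆ {x, x'} ×ˢ t := by
    rintro ⟨a, b⟩ hab
    rw [hmem] at hab
    simpa [hab.1.2] using hc a hab.1.1 b hab.1.2 hab.2
  have hsingle : ∀ z, ¬ E ⊆ {z} ×ˢ t := by
    intro z hz
    have := Finset.card_le_card hz
    rw [Finset.card_product, Finset.card_singleton, ht] at this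
    omega
  have hne : x ≠ x' := by
    rintro rfl
    exact hsingle x (by simpa using hsub)
  have hx : x ∈ s := by
    by_contra hx
    refine hsingle x' ?_
    rintro ⟨a, b⟩ hab
    have h1 := (hmem a b).1 hab
    have h2 := hc a h1.1.1 b h1.1.2 h1.2
    have h3 : a ≠ x := fun h => hx (h ▸ h1.1.1)
    simp [h1.1.2]; tauto
  have hx' : x' ∈ s := by
    by_contra hx'
    refine hsingle x ?_
    rintro ⟨a, b⟩ hab
    have h1 := (hmem a b).1 hab
    have h2 := hc a h1.1.1 b h1.1.2 h1.2
    have h3 : a ≠ x' := fun h => hx' (h ▸ h1.1.1)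
    simp [h1.1.2]; tauto
  have hcard : (({x, x'} : Finset α) ×ˢ t).card = 8 := by
    rw [Finset.card_product, Finset.card_pair hne, ht]
  refine ⟨⟨x, hx, x', hx', hne, fun y hy y' hy' hyy => ?_⟩, hcard ▸ Finset.card_le_card hsub⟩
  have hmiss : (({x, x'} ×ˢ t) \ E).card ≤ 1 := by
    rw [Finset.card_sdiff_of_subset hsub]
    omega
  rw [Finset.card_le_one] at hmiss
  have key : ∀ a a' b b', (a = x ∨ a = x') → (a' = x ∨ a' = x') → b ∈ t → b' ∈ t →
      b ≠ b' → h a b ∨ h a' b' := by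
    intro a a' b b' ha ha' hb hb' hbb
    by_contra hcon
    rw [not_or] at hcon
    have := hmiss (a, b) (by simp [hmem, ha, hb, hcon.1]) (a', b')
      (by simp [hmem, ha', hb', hcon.2])
    exact hbb (Prod.ext_iff.1 this).2
  have key2 : ∀ b ∈ t, h x b ∨ h x' b := by
    intro b hb
    by_contra hcon
    rw [not_or] at hcon
    have := hmiss (x, b) (by simp [hmem, hb, hcon.1]) (x', b) (by simp [hmem, hb, hcon.2])
    exact hne (Prod.ext_iff.1 this).1
  have k1 := key x x y y' (by simp) (by simp) hy hy' hyy
  have k2 := key x' x' y y' (by simp) (by simp) hy hy' hyy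
  have k3 := key x x' y y' (by simp) (by simp) hy hy' hyy
  have k4 := key x' x y y' (by simp) (by simp) hy hy' hyy
  have k5 := key2 y hy
  have k6 := key2 y' hy'
  tauto

theorem bipartite_trichotomy [DecidableEq β] {h : α → β → Prop} [∀ a b, Decidable (h a b)]
    {s : Finset α} {t : Finset β} (hs : s.card = 4) (ht : t.card = 4)
    (hno : ∀ a₁ ∈ s, ∀ a₂ ∈ s, ∀ a₃ ∈ s, ∀ b₁ ∈ t, ∀ b₂ ∈ t, ∀ b₃ ∈ t,
      h a₁ b₁ → h a₂ b₂ → h a₃ b₃ →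
      a₁ = a₂ ∨ a₁ = a₃ ∨ a₂ = a₃ ∨ b₁ = b₂ ∨ b₁ = b₃ ∨ b₂ = b₃) :
    ((s ×ˢ t).filter fun e => h e.1 e.2).card ≤ 6 ∨
    (((s ×ˢ t).filter fun e => h e.1 e.2).card ≤ 8 ∧
      (Dominates h s t ∨ Dominates (fun b a => h a b) t s)) ∨
    (((s ×ˢ t).filter fun e => h e.1 e.2).card ≤ 7 ∧ ∃ x y, IsCenter h s t x y) := by
  by_cases hE : ((s ×ˢ t).filter fun e => h e.1 e.2).card ≤ 6
  · exact Or.inl hE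
  right
  have hE : 7 ≤ ((s ×ˢ t).filter fun e => h e.1 e.2).card := by omega
  obtain ⟨⟨a₀, b₀⟩, h₀⟩ := Finset.card_pos.1
    (by omega : 0 < ((s ×ˢ t).filter fun e => h e.1 e.2).card)
  simp only [Finset.mem_filter, Finset.mem_product] at h₀
  have := exists_cover_of_no_three_matching (h := fun a b => a ∈ s ∧ b ∈ t ∧ h a b)
    (fun a₁ a₂ a₃ b₁ b₂ b₃ h1 h2 h3 => hno a₁ h1.1 a₂ h2.1 a₃ h3.1 b₁ h1.2.1 b₂ h2.2.1 b₃ h3.2.1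
      h1.2.2 h2.2.2 h3.2.2) (a₀ := a₀) (b₀ := b₀) ⟨h₀.1.1, h₀.1.2, h₀.2⟩
  rcases this with ⟨x, x', hc⟩ | ⟨y, y', hc⟩ | ⟨x, y, hc⟩
  · obtain ⟨h1, h2⟩ := dominates_of_cover ht hE (x := x) (x' := x')
      (fun a ha b hb hab => hc a b ⟨ha, hb, hab⟩)
    exact Or.inl ⟨h2, Or.inl h1⟩
  · have hswap : ((t ×ˢ s).filter fun e => h e.2 e.1).card =
        ((s ×ˢ t).filter fun e => h e.1 e.2).card := by
      refine Finset.card_bij' (fun e _ => e.swap) (fun e _ => e.swap) ?_ ?_ ?_ ?_ <;>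
        simp +contextual
    rw [← hswap] at hE ⊢
    obtain ⟨h1, h2⟩ := dominates_of_cover (h := fun b a => h a b) hs hE (x := y) (x' := y')
      (fun b hb a ha hab => hc a b ⟨ha, hb, hab⟩)
    exact Or.inl ⟨h2, Or.inr h1⟩
  · right
    set E := (s ×ˢ t).filter fun e => h e.1 e.2 with hEdef
    have hsub : E ⊆ ({x} ×ˢ t) ∪ (s.erase x ×ˢ {y}) := by
      rintro ⟨a, b⟩ hab
      simp only [hEdef, Finset.mem_filter, Finset.mem_product] at hab
      have := hc a b ⟨hab.1.1, hab.1.2, hab.2⟩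
      simp only [Finset.mem_union, Finset.mem_product, Finset.mem_singleton, Finset.mem_erase]
      tauto
    have hx : x ∈ s := by
      by_contra hx
      have : E ⊆ s ×ˢ {y} := by
        rintro ⟨a, b⟩ hab
        simp only [hEdef, Finset.mem_filter, Finset.mem_product] at hab
        have h1 := hc a b ⟨hab.1.1, hab.1.2, hab.2⟩
        have h2 : a ≠ x := fun h => hx (h ▸ hab.1.1)
        simp only [Finset.mem_product, Finset.mem_singleton]
        tauto
      have := Finset.card_le_card this
      rw [Finset.card_product, Finset.card_singleton, hs] at this
      omega
    have hy : y ∈ t := by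
      by_contra hy
      have : E ⊆ {x} ×ˢ t := by
        rintro ⟨a, b⟩ hab
        simp only [hEdef, Finset.mem_filter, Finset.mem_product] at hab
        have h1 := hc a b ⟨hab.1.1, hab.1.2, hab.2⟩
        have h2 : b ≠ y := fun h => hy (h ▸ hab.1.2)
        simp only [Finset.mem_product, Finset.mem_singleton]
        tauto
      have := Finset.card_le_card this
      rw [Finset.card_product, Finset.card_singleton, ht] at this
      omega
    have hcard : (({x} ×ˢ t) ∪ (s.erase x ×ˢ {y})).card ≤ 7 := by
      refine (Finset.card_union_le _ _).trans ?_
      rw [Finset.card_product, Finset.card_product, Finset.card_erase_of_mem hx]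
      simp [hs, ht]
    refine ⟨(Finset.card_le_card hsub).trans hcard, x, y, hx, hy, fun a ha b hb hab => ?_⟩
    have heq := Finset.eq_of_subset_of_card_le hsub (by omega)
    have : (a, b) ∈ E := by
      rw [heq]
      simp only [Finset.mem_union, Finset.mem_product, Finset.mem_singleton, Finset.mem_erase]
      tauto
    exact (Finset.mem_filter.1 this).2

end Bipartite

/-- A vertex set carrying a copy of `𝒴`. -/
def IsYSet (H : Finset (Finset α)) (s : Finset α) : Prop :=
  s.card = 4 ∧ ∃ a b c d, s = {a, b, c, d} ∧ ({a, b, c} : Finset α) ∈ H ∧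
    ({b, c, d} : Finset α) ∈ H

/-- A family of pairwise disjoint vertex sets of copies of `𝒴`. -/
structure IsPacking (H T : Finset (Finset α)) : Prop where
  isYSet : ∀ s ∈ T, IsYSet H s
  disj : (T : Set (Finset α)).PairwiseDisjoint id

/-- A `𝒴`-packing of maximum size. -/
structure IsMaxPacking (H T : Finset (Finset α)) : Prop extends IsPacking H T where
  card_le : ∀ T', IsPacking H T' → T'.card ≤ T.card

theorem IsPacking.eq_of_mem {H T : Finset (Finset α)} (hT : IsPacking H T) {s t : Finset α}
    (hs : s ∈ T) (ht : t ∈ T) {x : α} (hxs : x ∈ s) (hxt : x ∈ t) : s = t := by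
  by_contra hne
  exact Finset.disjoint_left.1 (hT.disj hs ht hne) hxs hxt

theorem IsPacking.empty (H : Finset (Finset α)) : IsPacking H ∅ :=
  ⟨by simp, by simp⟩

theorem IsPacking.insert {H N : Finset (Finset α)} (hN : IsPacking H N) {s : Finset α}
    (hs : IsYSet H s) (hd : Disjoint s (N.biUnion id)) : IsPacking H (insert s N) := by
  refine ⟨?_, ?_⟩
  · intro t ht
    rcases Finset.mem_insert.1 ht with rfl | ht
    · exact hs
    · exact hN.isYSet t ht
  · rw [Finset.coe_insert]
    refine hN.disj.insert fun t ht _ => ?_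
    exact hd.mono_right (Finset.subset_biUnion_of_mem id ht)

theorem IsYSet.notMem_of_disjoint {H N : Finset (Finset α)} {s : Finset α}
    (hs : IsYSet H s) (hd : Disjoint s (N.biUnion id)) : s ∉ N := by
  intro hsN
  have h0 : Disjoint s s := hd.mono_right (Finset.subset_biUnion_of_mem id hsN)
  have h1 := hs.1
  rw [disjoint_self.1 h0] at h1
  simp at h1

theorem ne_of_card_eq_three {a b c : α} (h : ({a, b, c} : Finset α).card = 3) :
    a ≠ b ∧ a ≠ c ∧ b ≠ c := by
  refine ⟨?_, ?_, ?_⟩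
  · rintro rfl
    have := Finset.card_le_two (a := a) (b := c)
    simp only [Finset.insert_idem] at h
    omega
  · rintro rfl
    have := Finset.card_le_two (a := a) (b := b)
    rw [Finset.pair_comm b a, Finset.insert_idem] at h
    omega
  · rintro rfl
    have := Finset.card_le_two (a := a) (b := b)
    rw [Finset.pair_eq_singleton] at h
    omega

theorem isYSet_of_edges {H : Finset (Finset α)} (h3 : ∀ e ∈ H, e.card = 3) {a b c d : α}
    (h1 : ({a, b, c} : Finset α) ∈ H) (h2 : ({b, c, d} : Finset α) ∈ H) (had : a ≠ d) :
    IsYSet H {a, b, c, d} := by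
  obtain ⟨hab, hac, hbc⟩ := ne_of_card_eq_three (h3 _ h1)
  obtain ⟨-, hbd, hcd⟩ := ne_of_card_eq_three (h3 _ h2)
  refine ⟨?_, a, b, c, d, rfl, h1, h2⟩
  rw [Finset.card_insert_of_notMem (by simp [*]), Finset.card_insert_of_notMem (by simp [*]),
    Finset.card_pair hcd]

theorem exists_four_of_card_eq_four {s : Finset α} (hs : s.card = 4) :
    ∃ a ∈ s, ∃ b ∈ s, ∃ c ∈ s, ∃ d ∈ s, a ≠ b ∧ a ≠ c ∧ a ≠ d ∧ b ≠ c ∧ b ≠ d ∧ c ≠ d := by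
  obtain ⟨a, t, hat, rfl, ht⟩ := Finset.card_eq_succ.1 hs
  obtain ⟨b, c, d, hbc, hbd, hcd, rfl⟩ := Finset.card_eq_three.1 ht
  refine ⟨a, by simp, b, by simp, c, by simp, d, by simp, ?_⟩
  simp at hat
  tauto

theorem exists_mem_notMem_pair {s : Finset α} (hs : s.card = 4) (a b : α) :
    ∃ x ∈ s, x ≠ a ∧ x ≠ b := by
  have := Finset.le_card_sdiff {a, b} s
  have h2 := Finset.card_le_two (a := a) (b := b)
  obtain ⟨x, hx⟩ := Finset.card_pos.1 (by omega : 0 < (s \ {a, b}).card)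
  simp only [Finset.mem_sdiff, Finset.mem_insert, Finset.mem_singleton, not_or] at hx
  exact ⟨x, hx.1, hx.2⟩

/-- The vertices of `U` forming an edge with `p` and `q`. -/
def link (H : Finset (Finset α)) (U : Finset α) (p q : α) : Finset α :=
  U.filter fun x => ({x, p, q} : Finset α) ∈ H

theorem link_comm (H : Finset (Finset α)) (U : Finset α) (p q : α) :
    link H U p q = link H U q p := by
  unfold link
  congr 1; ext x; rw [Finset.pair_comm p q]

/-- A vertex with many edges to `U` lies in a copy of `𝒴` whose other three vertices
are in `U` and avoid a prescribed set of three vertices. -/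
theorem exists_isYSet_of_sum_card_link {H : Finset (Finset α)} (h3 : ∀ e ∈ H, e.card = 3)
    {U W : Finset α} (hW : W.card ≤ 3) {q : α}
    (hq : 7 * U.card < ∑ p ∈ U, (link H U p q).card) :
    ∃ x p y, IsYSet H {x, p, q, y} ∧ (x ∈ U ∧ p ∈ U ∧ y ∈ U) ∧ x ∉ W ∧ p ∉ W ∧ y ∉ W := by
  by_contra! hno
  have hle : ∀ p, (link H U p q).card ≤ U.card := fun p => Finset.card_filter_le _ _
  have h4 : ∀ p ∈ U \ W, (link H U p q).card ≤ 4 := by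
    intro p hp
    by_contra! hlt
    have h1 := Finset.le_card_sdiff W (link H U p q)
    obtain ⟨x, hx, y, hy, hxy⟩ :=
      Finset.one_lt_card.1 (by omega : 1 < (link H U p q \ W).card)
    simp only [link, Finset.mem_filter, Finset.mem_sdiff] at hx hy hp
    have hY : IsYSet H {x, p, q, y} := by
      refine isYSet_of_edges h3 hx.1.2 ?_ hxy
      convert hy.1.2 using 1
      ext z; simp; tauto
    exact hy.2 (hno x p y hY ⟨hx.1.1, hp.1, hy.1.1⟩ hx.2 hp.2)
  have hsplit := Finset.sum_inter_add_sum_sdiff U W (fun p => (link H U p q).card)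
  have h1 : ∑ p ∈ U ∩ W, (link H U p q).card ≤ 3 * U.card := by
    refine (Finset.sum_le_card_nsmul _ _ U.card fun p _ => hle p).trans ?_
    rw [smul_eq_mul]
    exact Nat.mul_le_mul_right _ ((Finset.card_le_card Finset.inter_subset_right).trans hW)
  have h2 : ∑ p ∈ U \ W, (link H U p q).card ≤ 4 * U.card := by
    refine (Finset.sum_le_card_nsmul _ _ 4 h4).trans ?_
    rw [smul_eq_mul, mul_comm]
    exact Nat.mul_le_mul_left _ (Finset.card_le_card Finset.sdiff_subset)
  omega

theorem IsPacking.card_biUnion {H T : Finset (Finset α)} (hT : IsPacking H T) :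
    (T.biUnion id).card = 4 * T.card := by
  rw [Finset.card_biUnion hT.disj]
  simp only [id]
  rw [Finset.sum_congr rfl fun s hs => (hT.isYSet s hs).1]
  simp [mul_comm]

theorem IsPacking.exists_isYTiling {H T : Finset (Finset α)} (hT : IsPacking H T) :
    ∃ f : Fin T.card → Fin 4 → α, IsYTiling H T.card f := by
  have hex : ∀ i : Fin T.card, ∃ g : Fin 4 → α, Function.Injective g ∧
      (∀ j, g j ∈ (T.equivFin.symm i : Finset α)) ∧ ({g 0, g 1, g 2} : Finset α) ∈ H ∧
      ({g 1, g 2, g 3} : Finset α) ∈ H := by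
    intro i
    obtain ⟨hcard, a, b, c, d, heq, h1, h2⟩ := hT.isYSet _ (T.equivFin.symm i).2
    refine ⟨![a, b, c, d], ?_, ?_, by simpa using h1, by simpa using h2⟩
    · have himg : Finset.univ.image ![a, b, c, d] = {a, b, c, d} := by
        ext z
        simp [Fin.exists_fin_succ, eq_comm]
      rw [← Set.injOn_univ, ← Finset.coe_univ, ← Finset.card_image_iff, himg, ← heq, hcard]
      rfl
    · intro j
      rw [heq]
      fin_cases j <;> simp
  choose f hinj hmem h1 h2 using hex
  refine ⟨f, ?_, fun i => ⟨h1 i, h2 i⟩⟩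
  rintro ⟨i, j⟩ ⟨i', j'⟩ h
  simp only at h
  have hii : i = i' := by
    have := hT.eq_of_mem (T.equivFin.symm i).2 (T.equivFin.symm i').2 (hmem i j) (h ▸ hmem i' j')
    exact T.equivFin.symm.injective (Subtype.ext this)
  subst hii
  rw [hinj i h]

variable [Fintype α]

/-- The vertices not covered by `T`. -/
def free (T : Finset (Finset α)) : Finset α := (T.biUnion id)ᶜ

theorem mem_free {T : Finset (Finset α)} {x : α} : x ∈ free T ↔ ∀ s ∈ T, x ∉ s := by
  simp [free]

theorem IsMaxPacking.card_le_of_replace {H T R N : Finset (Finset α)} (hT : IsMaxPacking H T)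
    (hR : R ⊆ T) (hN : IsPacking H N) (hsub : ∀ s ∈ N, s ⊆ free T ∪ R.biUnion id) :
    N.card ≤ R.card := by
  have key : ∀ s ∈ T \ R, ∀ t ∈ N, Disjoint s t := by
    intro s hs t ht
    rw [Finset.mem_sdiff] at hs
    refine Finset.disjoint_left.2 fun x hxs hxt => ?_
    rcases Finset.mem_union.1 (hsub t ht hxt) with hx | hx
    · exact mem_free.1 hx s hs.1 hxs
    · obtain ⟨r, hr, hxr⟩ := Finset.mem_biUnion.1 hx
      exact hs.2 (hT.eq_of_mem hs.1 (hR hr) hxs hxr ▸ hr)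
  have hpack : IsPacking H (T \ R ∪ N) := by
    refine ⟨?_, ?_⟩
    · intro s hs
      rcases Finset.mem_union.1 hs with hs | hs
      · exact hT.isYSet s (Finset.mem_sdiff.1 hs).1
      · exact hN.isYSet s hs
    · rw [Finset.coe_union]
      refine Set.PairwiseDisjoint.union (hT.disj.subset (by simp)) hN.disj ?_
      intro s hs t ht _
      exact key s hs t ht
  have hdisj : Disjoint (T \ R) N := by
    refine Finset.disjoint_left.2 fun s hs hsN => ?_
    have h0 := key s hs s hsN
    have h1 := (hN.isYSet s hsN).1
    rw [disjoint_self.1 h0] at h1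
    simp at h1
  have := hT.card_le _ hpack
  rw [Finset.card_union_of_disjoint hdisj, Finset.card_sdiff_of_subset hR] at this
  have := Finset.card_le_card hR
  omega

/-- `p` and `q` have at least eight common neighbours outside `T`. -/
def Heavy (H T : Finset (Finset α)) (p q : α) : Prop := 8 ≤ (link H (free T) p q).card

theorem Heavy.symm {H T : Finset (Finset α)} {p q : α} (h : Heavy H T p q) : Heavy H T q p := by
  rwa [Heavy, link_comm]

/-- A matching of heavy pairs inside `⋃ R`, together with disjoint copies of `𝒴`,
cannot outnumber `R`. -/
theorem IsMaxPacking.card_add_length_le {H T R : Finset (Finset α)} (h3 : ∀ e ∈ H, e.card = 3)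
    (hT : IsMaxPacking H T) (hR : R ⊆ T) (L : List (α × α)) :
    ∀ N : Finset (Finset α), IsPacking H N → (∀ s ∈ N, s ⊆ free T ∪ R.biUnion id) →
      (N.biUnion id ∩ free T).card + 2 * L.length ≤ 8 →
      (∀ e ∈ L, Heavy H T e.1 e.2 ∧ e.1 ∈ R.biUnion id ∧ e.2 ∈ R.biUnion id ∧
        e.1 ∉ N.biUnion id ∧ e.2 ∉ N.biUnion id) →
      (L.flatMap fun e => [e.1, e.2]).Nodup → N.card + L.length ≤ R.card := by
  induction L with
  | nil =>
    intro N hN hsub _ _ _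
    simpa using hT.card_le_of_replace hR hN hsub
  | cons e L ih =>
    obtain ⟨p, q⟩ := e
    intro N hN hsub hcard hL hnd
    obtain ⟨hh, hp, hq, hpN, hqN⟩ := hL (p, q) (by simp)
    simp only at hh hp hq hpN hqN
    simp only [List.length_cons] at hcard ⊢
    have hfree : ∀ x ∈ R.biUnion id, x ∉ free T := by
      intro x hx hxf
      obtain ⟨r, hr, hxr⟩ := Finset.mem_biUnion.1 hx
      exact mem_free.1 hxf r (hR hr) hxr
    have hlt : 1 < (link H (free T) p q \ (N.biUnion id ∩ free T)).card := by
      have := Finset.le_card_sdiff (N.biUnion id ∩ free T) (link H (free T) p q)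
      unfold Heavy at hh
      omega
    obtain ⟨x, hx, y, hy, hxy⟩ := Finset.one_lt_card.1 hlt
    simp only [link, Finset.mem_sdiff, Finset.mem_filter, Finset.mem_inter, not_and'] at hx hy
    obtain ⟨⟨hxf, hxe⟩, hxN⟩ := hx
    obtain ⟨⟨hyf, hye⟩, hyN⟩ := hy
    have hxN := hxN hxf
    have hyN := hyN hyf
    have hY : IsYSet H {x, p, q, y} := by
      refine isYSet_of_edges h3 hxe ?_ hxy
      convert hye using 1
      ext z; simp; tauto
    have hd : Disjoint ({x, p, q, y} : Finset α) (N.biUnion id) := by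
      rw [Finset.disjoint_left]
      intro z hz
      simp only [Finset.mem_insert, Finset.mem_singleton] at hz
      rcases hz with rfl | rfl | rfl | rfl <;> assumption
    have hmemN : ∀ z, z ∈ (Insert.insert ({x, p, q, y} : Finset α) N).biUnion id ↔
        (z = x ∨ z = p ∨ z = q ∨ z = y) ∨ z ∈ N.biUnion id := by
      intro z
      simp only [Finset.biUnion_insert, id, Finset.mem_union, Finset.mem_insert,
        Finset.mem_singleton]
    have := ih (Insert.insert {x, p, q, y} N) (hN.insert hY hd) ?_ ?_ ?_ ?_
    · rw [Finset.card_insert_of_notMem (hY.notMem_of_disjoint hd)] at this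
      omega
    · intro s hs
      rcases Finset.mem_insert.1 hs with rfl | hs
      · intro z hz
        simp only [Finset.mem_insert, Finset.mem_singleton] at hz
        rw [Finset.mem_union]
        rcases hz with rfl | rfl | rfl | rfl <;> tauto
      · exact hsub s hs
    · have : ((Insert.insert ({x, p, q, y} : Finset α) N).biUnion id ∩ free T) ⊆
          (N.biUnion id ∩ free T) ∪ {x, y} := by
        intro z hz
        rw [Finset.mem_inter, hmemN] at hz
        have := hfree p hp
        have := hfree q hq
        simp only [Finset.mem_union, Finset.mem_inter, Finset.mem_insert, Finset.mem_singleton]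
        obtain ⟨(rfl | rfl | rfl | rfl) | h, h'⟩ := hz <;> tauto
      have h1 := Finset.card_le_card this
      have h2 := Finset.card_union_le (N.biUnion id ∩ free T) {x, y}
      have h3 : ({x, y} : Finset α).card ≤ 2 := Finset.card_le_two
      omega
    · intro e he
      obtain ⟨a1, a2, a3, a4, a5⟩ := hL e (List.mem_cons_of_mem _ he)
      have hx1 := fun h : e.1 = x => hfree _ a2 (h ▸ hxf)
      have hy1 := fun h : e.1 = y => hfree _ a2 (h ▸ hyf)
      have hx2 := fun h : e.2 = x => hfree _ a3 (h ▸ hxf)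
      have hy2 := fun h : e.2 = y => hfree _ a3 (h ▸ hyf)
      simp only [List.flatMap_cons, List.cons_append, List.nil_append, List.nodup_cons,
        List.mem_cons, List.mem_flatMap, not_or, not_exists, not_and] at hnd
      obtain ⟨⟨-, hpL⟩, hqL, -⟩ := hnd
      obtain ⟨hp1, hp2⟩ : e.1 ≠ p ∧ e.2 ≠ p := by
        have := hpL e he
        exact ⟨Ne.symm this.1, Ne.symm this.2.1⟩
      obtain ⟨hq1, hq2⟩ : e.1 ≠ q ∧ e.2 ≠ q := by
        have := hqL e he
        exact ⟨Ne.symm this.1, Ne.symm this.2.1⟩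
      refine ⟨a1, a2, a3, fun h => ?_, fun h => ?_⟩
      · rcases (hmemN _).1 h with (h | h | h | h) | h
        exacts [hx1 h, hp1 h, hq1 h, hy1 h, a4 h]
      · rcases (hmemN _).1 h with (h | h | h | h) | h
        exacts [hx2 h, hp2 h, hq2 h, hy2 h, a5 h]
    · simp only [List.flatMap_cons, List.cons_append, List.nil_append, List.nodup_cons] at hnd
      exact hnd.2.2

instance (H T : Finset (Finset α)) (p q : α) : Decidable (Heavy H T p q) :=
  inferInstanceAs (Decidable (_ ≤ _))

theorem IsMaxPacking.length_le {H T : Finset (Finset α)} (h3 : ∀ e ∈ H, e.card = 3)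
    (hT : IsMaxPacking H T) {R : Finset (Finset α)} (hR : R ⊆ T) (L : List (α × α))
    (hlen : L.length ≤ 4)
    (hL : ∀ e ∈ L, Heavy H T e.1 e.2 ∧ e.1 ∈ R.biUnion id ∧ e.2 ∈ R.biUnion id)
    (hnd : (L.flatMap fun e => [e.1, e.2]).Nodup) : L.length ≤ R.card := by
  have := hT.card_add_length_le h3 hR L ∅ (IsPacking.empty H) (by simp) (by simp; omega)
    (fun e he => by simpa using hL e he) hnd
  simpa using this

theorem IsMaxPacking.no_three_matching {H T : Finset (Finset α)} (h3 : ∀ e ∈ H, e.card = 3)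
    (hT : IsMaxPacking H T) {s t : Finset α} (hs : s ∈ T) (ht : t ∈ T) (hst : s ≠ t) :
    ∀ a₁ ∈ s, ∀ a₂ ∈ s, ∀ a₃ ∈ s, ∀ b₁ ∈ t, ∀ b₂ ∈ t, ∀ b₃ ∈ t,
      Heavy H T a₁ b₁ → Heavy H T a₂ b₂ → Heavy H T a₃ b₃ →
      a₁ = a₂ ∨ a₁ = a₃ ∨ a₂ = a₃ ∨ b₁ = b₂ ∨ b₁ = b₃ ∨ b₂ = b₃ := by
  intro a₁ ha₁ a₂ ha₂ a₃ ha₃ b₁ hb₁ b₂ hb₂ b₃ hb₃ h1 h2 h3'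
  by_contra hcon
  simp only [not_or] at hcon
  have ne : ∀ a ∈ s, ∀ b ∈ t, a ≠ b := fun a ha b hb h => hst (hT.eq_of_mem hs ht ha (h ▸ hb))
  have := hT.length_le h3 (R := {s, t}) (by simp [Finset.insert_subset_iff, hs, ht])
    [(a₁, b₁), (a₂, b₂), (a₃, b₃)] (by simp) (by simp [*]) (by
      simp only [List.flatMap_cons, List.flatMap_nil, List.cons_append, List.nil_append,
        List.nodup_cons, List.mem_cons, List.not_mem_nil]
      grind)
  have := (Finset.card_le_two (a := s) (b := t))
  simp only [List.length_cons, List.length_nil] at *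
  omega

/-- At most one member of a maximum packing dominates a given member. -/
theorem IsMaxPacking.dominates_unique {H T : Finset (Finset α)} (h3 : ∀ e ∈ H, e.card = 3)
    (hT : IsMaxPacking H T) {s t w : Finset α} (hs : s ∈ T) (ht : t ∈ T) (hw : w ∈ T)
    (hst : s ≠ t) (hwt : w ≠ t) (h1 : Dominates (Heavy H T) s t)
    (h2 : Dominates (Heavy H T) w t) : s = w := by
  by_contra hsw
  obtain ⟨x, hx, x', hx', hxx, hx2⟩ := h1
  obtain ⟨z, hz, z', hz', hzz, hz2⟩ := h2
  have ne1 : ∀ a ∈ s, ∀ b ∈ t, a ≠ b := fun a ha b hb h => hst (hT.eq_of_mem hs ht ha (h ▸ hb))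
  have ne2 : ∀ a ∈ w, ∀ b ∈ t, a ≠ b := fun a ha b hb h => hwt (hT.eq_of_mem hw ht ha (h ▸ hb))
  have ne3 : ∀ a ∈ s, ∀ b ∈ w, a ≠ b := fun a ha b hb h => hsw (hT.eq_of_mem hs hw ha (h ▸ hb))
  have key : ∀ p ∈ t, ∀ q ∈ t, ∀ p' ∈ t, ∀ q' ∈ t, p ≠ q → p ≠ p' → p ≠ q' → q ≠ p' → q ≠ q' →
      p' ≠ q' → Heavy H T x p → Heavy H T x' q → Heavy H T z p' → Heavy H T z' q' → False := by
    intro p hp q hq p' hp' q' hq' n1 n2 n3 n4 n5 n6 e1 e2 e3 e4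
    have := hT.length_le h3 (R := {s, t, w}) (by simp [Finset.insert_subset_iff, hs, ht, hw])
      [(x, p), (x', q), (z, p'), (z', q')] (by simp) (by simp [*]) (by
        simp only [List.flatMap_cons, List.flatMap_nil, List.cons_append, List.nil_append,
          List.nodup_cons, List.mem_cons, List.not_mem_nil]
        grind)
    have := (Finset.card_le_three (a := s) (b := t) (c := w))
    simp only [List.length_cons, List.length_nil] at *
    omega
  obtain ⟨a, ha, b, hb, c, hc, d, hd, n1, n2, n3, n4, n5, n6⟩ :=
    exists_four_of_card_eq_four (hT.isYSet t ht).1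
  rcases hx2 a ha b hb n1 with ⟨e1, e2⟩ | ⟨e1, e2⟩ <;>
    rcases hz2 c hc d hd n6 with ⟨e3, e4⟩ | ⟨e3, e4⟩
  · exact key a ha b hb c hc d hd n1 n2 n3 n4 n5 n6 e1 e2 e3 e4
  · exact key a ha b hb d hd c hc n1 n3 n2 n5 n4 n6.symm e1 e2 e3 e4
  · exact key b hb a ha c hc d hd n1.symm n4 n5 n2 n3 n6 e1 e2 e3 e4
  · exact key b hb a ha d hd c hc n1.symm n5 n4 n3 n2 n6.symm e1 e2 e3 e4

/-- All double stars at a member of a maximum packing have the same centre there. -/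
theorem IsMaxPacking.center_unique {H T : Finset (Finset α)} (h3 : ∀ e ∈ H, e.card = 3)
    (hT : IsMaxPacking H T) {s t w : Finset α} (hs : s ∈ T) (ht : t ∈ T) (hw : w ∈ T)
    (hst : s ≠ t) (hsw : s ≠ w) {x y x' z : α} (h1 : IsCenter (Heavy H T) s t x y)
    (h2 : IsCenter (Heavy H T) s w x' z) : x = x' := by
  by_contra hxx
  obtain ⟨hx, hy, h1⟩ := h1
  obtain ⟨hx', hz, h2⟩ := h2
  have hs4 := (hT.isYSet s hs).1
  have ht4 := (hT.isYSet t ht).1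
  have hw4 := (hT.isYSet w hw).1
  obtain ⟨c, hc, hcx, hcx'⟩ := exists_mem_notMem_pair hs4 x x'
  by_cases htw : t = w
  · subst htw
    obtain ⟨b, hb, hby, -⟩ := exists_mem_notMem_pair ht4 y y
    obtain ⟨b', hb', hby', hbb⟩ := exists_mem_notMem_pair ht4 y b
    have := hT.no_three_matching h3 hs ht hst x hx x' hx' c hc b hb b' hb' y hy
      (h1 x hx b hb (Or.inl rfl)) (h2 x' hx' b' hb' (Or.inl rfl)) (h1 c hc y hy (Or.inr rfl))
    grind
  · have hd : ∃ d ∈ s, d ≠ x ∧ d ≠ x' ∧ d ≠ c := by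
      have := Finset.le_card_sdiff {x, x', c} s
      have h2 := Finset.card_le_three (a := x) (b := x') (c := c)
      obtain ⟨d, hd⟩ := Finset.card_pos.1 (by omega : 0 < (s \ {x, x', c}).card)
      simp only [Finset.mem_sdiff, Finset.mem_insert, Finset.mem_singleton, not_or] at hd
      exact ⟨d, hd.1, hd.2⟩
    obtain ⟨d, hd, hdx, hdx', hdc⟩ := hd
    obtain ⟨b, hb, hby, -⟩ := exists_mem_notMem_pair ht4 y y
    obtain ⟨b', hb', hbz, -⟩ := exists_mem_notMem_pair hw4 z z
    have ne1 : ∀ a ∈ s, ∀ b ∈ t, a ≠ b := fun a ha b hb h => hst (hT.eq_of_mem hs ht ha (h ▸ hb))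
    have ne2 : ∀ a ∈ t, ∀ b ∈ w, a ≠ b := fun a ha b hb h => htw (hT.eq_of_mem ht hw ha (h ▸ hb))
    have ne3 : ∀ a ∈ s, ∀ b ∈ w, a ≠ b := fun a ha b hb h => hsw (hT.eq_of_mem hs hw ha (h ▸ hb))
    have e1 := h1 x hx b hb (Or.inl rfl)
    have e2 := h2 x' hx' b' hb' (Or.inl rfl)
    have e3 := h1 c hc y hy (Or.inr rfl)
    have e4 := h2 d hd z hz (Or.inr rfl)
    have := hT.length_le h3 (R := {s, t, w}) (by simp [Finset.insert_subset_iff, hs, ht, hw])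
      [(x, b), (x', b'), (c, y), (d, z)] (by simp) (by simp [*]) (by
        simp only [List.flatMap_cons, List.flatMap_nil, List.cons_append, List.nil_append,
          List.nodup_cons, List.mem_cons, List.not_mem_nil]
        grind)
    have := (Finset.card_le_three (a := s) (b := t) (c := w))
    simp only [List.length_cons, List.length_nil] at *
    omega

/-- A copy of `𝒴` avoiding the centres of four pairwise distinct members yields a larger packing. -/
theorem IsMaxPacking.no_crossing_isYSet {H T : Finset (Finset α)} (h3 : ∀ e ∈ H, e.card = 3)
    (hT : IsMaxPacking H T) {s₁ s₂ s₃ s₄ : Finset α} (hs₁ : s₁ ∈ T) (hs₂ : s₂ ∈ T)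
    (hs₃ : s₃ ∈ T) (hs₄ : s₄ ∈ T) (h12 : s₁ ≠ s₂) (h13 : s₁ ≠ s₃) (h14 : s₁ ≠ s₄) (h23 : s₂ ≠ s₃)
    (h24 : s₂ ≠ s₄) (h34 : s₃ ≠ s₄) {x₁ x₂ x₃ x₄ a b c d : α}
    (hc12 : IsCenter (Heavy H T) s₁ s₂ x₁ x₂) (hc34 : IsCenter (Heavy H T) s₃ s₄ x₃ x₄)
    (ha : a ∈ s₁) (hb : b ∈ s₂) (hc : c ∈ s₃) (hd : d ∈ s₄) (hax : a ≠ x₁) (hbx : b ≠ x₂)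
    (hcx : c ≠ x₃) (hdx : d ≠ x₄) (h1 : ({a, b, c} : Finset α) ∈ H)
    (h2 : ({b, c, d} : Finset α) ∈ H) : False := by
  obtain ⟨hx₁, hx₂, hc12⟩ := hc12
  obtain ⟨hx₃, hx₄, hc34⟩ := hc34
  have ne : ∀ s ∈ T, ∀ t ∈ T, s ≠ t → ∀ a ∈ s, ∀ b ∈ t, a ≠ b :=
    fun s hs t ht hst a ha b hb h => hst (hT.eq_of_mem hs ht ha (h ▸ hb))
  have n12 := ne s₁ hs₁ s₂ hs₂ h12
  have n13 := ne s₁ hs₁ s₃ hs₃ h13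
  have n14 := ne s₁ hs₁ s₄ hs₄ h14
  have n23 := ne s₂ hs₂ s₃ hs₃ h23
  have n24 := ne s₂ hs₂ s₄ hs₄ h24
  have n34 := ne s₃ hs₃ s₄ hs₄ h34
  obtain ⟨y₁, hy₁, hyx₁, hya⟩ := exists_mem_notMem_pair (hT.isYSet s₁ hs₁).1 x₁ a
  obtain ⟨y₂, hy₂, hyx₂, hyb⟩ := exists_mem_notMem_pair (hT.isYSet s₂ hs₂).1 x₂ b
  obtain ⟨y₃, hy₃, hyx₃, hyc⟩ := exists_mem_notMem_pair (hT.isYSet s₃ hs₃).1 x₃ c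
  obtain ⟨y₄, hy₄, hyx₄, hyd⟩ := exists_mem_notMem_pair (hT.isYSet s₄ hs₄).1 x₄ d
  have hY : IsYSet H {a, b, c, d} := isYSet_of_edges h3 h1 h2 (n14 a ha d hd)
  have e1 := hc12 x₁ hx₁ y₂ hy₂ (Or.inl rfl)
  have e2 := hc12 y₁ hy₁ x₂ hx₂ (Or.inr rfl)
  have e3 := hc34 x₃ hx₃ y₄ hy₄ (Or.inl rfl)
  have e4 := hc34 y₃ hy₃ x₄ hx₄ (Or.inr rfl)
  have hR : ({s₁, s₂, s₃, s₄} : Finset (Finset α)) ⊆ T := by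
    simp [Finset.insert_subset_iff, hs₁, hs₂, hs₃, hs₄]
  have hmem : ∀ v, v ∈ ({s₁, s₂, s₃, s₄} : Finset (Finset α)).biUnion id ↔
      v ∈ s₁ ∨ v ∈ s₂ ∨ v ∈ s₃ ∨ v ∈ s₄ := by simp
  have hsub : ({a, b, c, d} : Finset α) ⊆ ({s₁, s₂, s₃, s₄} : Finset (Finset α)).biUnion id := by
    intro v hv
    rw [hmem]
    simp only [Finset.mem_insert, Finset.mem_singleton] at hv
    rcases hv with rfl | rfl | rfl | rfl <;> tauto
  have hfree : ({a, b, c, d} : Finset α) ∩ free T = ∅ := by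
    rw [← Finset.disjoint_iff_inter_eq_empty, Finset.disjoint_left]
    intro v hv hvf
    obtain ⟨r, hr, hvr⟩ := Finset.mem_biUnion.1 (hsub hv)
    exact mem_free.1 hvf r (hR hr) hvr
  have hpack : IsPacking H {{a, b, c, d}} := ⟨by simpa using hY, by simp⟩
  have := hT.card_add_length_le h3 hR
    [(x₁, y₂), (y₁, x₂), (x₃, y₄), (y₃, x₄)] {{a, b, c, d}} hpack
    (by
      intro s hs
      rw [Finset.mem_singleton] at hs
      subst hs
      exact hsub.trans Finset.subset_union_right)
    (by simp only [Finset.singleton_biUnion, id, hfree]; simp)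
    (by
      intro e he
      simp only [List.mem_cons, List.not_mem_nil, or_false] at he
      simp only [hmem, Finset.singleton_biUnion, id, Finset.mem_insert, Finset.mem_singleton]
      rcases he with rfl | rfl | rfl | rfl <;> grind)
    (by
      simp only [List.flatMap_cons, List.flatMap_nil, List.cons_append, List.nil_append,
        List.nodup_cons, List.mem_cons, List.not_mem_nil]
      grind)
  have := (Finset.card_le_four (a := s₁) (b := s₂) (c := s₃) (d := s₄))
  simp only [List.length_cons, List.length_nil, Finset.card_singleton] at *
  omega

theorem IsMaxPacking.card_link_le_one {H T : Finset (Finset α)} (h3 : ∀ e ∈ H, e.card = 3)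
    (hT : IsMaxPacking H T) {p q : α} (hp : p ∈ free T) (hq : q ∈ free T) :
    (link H (free T) p q).card ≤ 1 := by
  by_contra! hlt
  obtain ⟨x, hx, y, hy, hxy⟩ := Finset.one_lt_card.1 hlt
  simp only [link, Finset.mem_filter] at hx hy
  have hY : IsYSet H {x, p, q, y} := by
    refine isYSet_of_edges h3 hx.2 ?_ hxy
    convert hy.2 using 1
    ext z; simp; tauto
  have := hT.card_le_of_replace (R := ∅) (N := {{x, p, q, y}}) (by simp)
    ⟨by simpa using hY, by simp⟩ (by
      intro s hs z hz
      rw [Finset.mem_singleton] at hs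
      subst hs
      simp only [Finset.mem_insert, Finset.mem_singleton] at hz
      refine Finset.mem_union_left _ ?_
      rcases hz with rfl | rfl | rfl | rfl <;> tauto)
  simp at this

theorem IsMaxPacking.sum_link_free_le {H T : Finset (Finset α)} (h3 : ∀ e ∈ H, e.card = 3)
    (hT : IsMaxPacking H T) {s : Finset α} (hs : s ∈ T) :
    ∑ q ∈ s, ∑ p ∈ free T, (link H (free T) p q).card ≤
      (free T).card ^ 2 + 28 * (free T).card := by
  set U := free T with hU
  have hs4 := (hT.isYSet s hs).1
  have hall : ∀ q, ∑ p ∈ U, (link H U p q).card ≤ U.card ^ 2 := by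
    intro q
    refine (Finset.sum_le_card_nsmul _ _ U.card fun p _ => Finset.card_filter_le _ _).trans ?_
    rw [smul_eq_mul, sq]
  have huniq : ∀ q ∈ s, ∀ q' ∈ s, 7 * U.card < ∑ p ∈ U, (link H U p q).card →
      7 * U.card < ∑ p ∈ U, (link H U p q').card → q = q' := by
    intro q hq q' hq' h1 h2
    by_contra hne
    have hns : ∀ z ∈ s, z ∉ U := fun z hz hzU => mem_free.1 hzU s hs hz
    obtain ⟨x, p, y, hY, ⟨hx, hp, hy⟩, -⟩ :=
      exists_isYSet_of_sum_card_link h3 (W := ∅) (by simp) h1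
    obtain ⟨x', p', y', hY', ⟨hx', hp', hy'⟩, hxW, hpW, hyW⟩ :=
      exists_isYSet_of_sum_card_link h3 (W := {x, p, y}) Finset.card_le_three h2
    simp only [Finset.mem_insert, Finset.mem_singleton, not_or] at hxW hpW hyW
    have hd : Disjoint ({x', p', q', y'} : Finset α)
        (({{x, p, q, y}} : Finset (Finset α)).biUnion id) := by
      have nU : ∀ z ∈ s, ∀ w ∈ U, w ≠ z := fun z hz w hw h => hns z hz (h ▸ hw)
      rw [Finset.singleton_biUnion, Finset.disjoint_left]
      intro z hz
      simp only [id, Finset.mem_insert, Finset.mem_singleton] at hz ⊢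
      rcases hz with rfl | rfl | rfl | rfl <;> grind
    have hpk : IsPacking H {{x, p, q, y}} := ⟨by simpa using hY, by simp⟩
    have := hT.card_le_of_replace (R := {s}) (by simpa using hs) (hpk.insert hY' hd) (by
      intro t ht z hz
      rw [Finset.singleton_biUnion, id, Finset.mem_union, ← hU]
      rcases Finset.mem_insert.1 ht with rfl | ht
      · simp only [Finset.mem_insert, Finset.mem_singleton] at hz
        rcases hz with rfl | rfl | rfl | rfl <;> tauto
      · rw [Finset.mem_singleton] at ht
        subst ht
        simp only [Finset.mem_insert, Finset.mem_singleton] at hz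
        rcases hz with rfl | rfl | rfl | rfl <;> tauto)
    rw [Finset.card_insert_of_notMem (hY'.notMem_of_disjoint hd)] at this
    simp at this
  by_cases hex : ∃ q ∈ s, 7 * U.card < ∑ p ∈ U, (link H U p q).card
  · obtain ⟨q, hq, hrich⟩ := hex
    rw [← Finset.add_sum_erase s _ hq]
    have h1 : ∑ r ∈ s.erase q, ∑ p ∈ U, (link H U p r).card ≤ (s.erase q).card • (7 * U.card) := by
      refine Finset.sum_le_card_nsmul _ _ _ fun r hr => ?_
      rw [Finset.mem_erase] at hr
      by_contra! hlt
      exact hr.1 (huniq r hr.2 q hq hlt hrich)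
    rw [Finset.card_erase_of_mem hq, hs4, smul_eq_mul] at h1
    have := hall q
    omega
  · push Not at hex
    have := Finset.sum_le_card_nsmul s _ _ hex
    rw [hs4, smul_eq_mul] at this
    have : 0 ≤ U.card ^ 2 := by positivity
    omega

/-- The number of heavy pairs between `s` and `t`. -/
def heavyCount (H T : Finset (Finset α)) (s t : Finset α) : ℕ :=
  ((s ×ˢ t).filter fun e => Heavy H T e.1 e.2).card

theorem sum_link_le {H T : Finset (Finset α)} {s t : Finset α} (hs : s.card = 4)
    (ht : t.card = 4) : ∑ p ∈ s, ∑ q ∈ t, (link H (free T) p q).card ≤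
      heavyCount H T s t * (free T).card + 112 := by
  rw [← Finset.sum_product' s t fun p q => (link H (free T) p q).card]
  calc ∑ e ∈ s ×ˢ t, (link H (free T) e.1 e.2).card
      ≤ ∑ e ∈ s ×ˢ t, ((if Heavy H T e.1 e.2 then (free T).card else 0) + 7) := by
        refine Finset.sum_le_sum fun e _ => ?_
        split_ifs with h
        · exact (Finset.card_filter_le _ _).trans (Nat.le_add_right _ _)
        · unfold Heavy at h; omega
    _ = heavyCount H T s t * (free T).card + 112 := by
        rw [Finset.sum_add_distrib, ← Finset.sum_filter]
        simp [heavyCount, hs, ht]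

theorem dominates_heavy_swap {H T : Finset (Finset α)} {s t : Finset α}
    (h : Dominates (fun b a => Heavy H T a b) t s) : Dominates (Heavy H T) t s := by
  have : (fun b a => Heavy H T a b) = Heavy H T := by
    funext b a
    exact propext ⟨Heavy.symm, Heavy.symm⟩
  rwa [this] at h

theorem IsCenter.heavy_symm {H T : Finset (Finset α)} {s t : Finset α} {x y : α}
    (h : IsCenter (Heavy H T) s t x y) : IsCenter (Heavy H T) t s y x :=
  ⟨h.2.1, h.1, fun a ha b hb hab => (h.2.2 b hb a ha hab.symm).symm⟩

theorem IsMaxPacking.trichotomy {H T : Finset (Finset α)} (h3 : ∀ e ∈ H, e.card = 3)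
    (hT : IsMaxPacking H T) {s t : Finset α} (hs : s ∈ T) (ht : t ∈ T) (hst : s ≠ t) :
    heavyCount H T s t ≤ 6 ∨ (heavyCount H T s t ≤ 8 ∧
      (Dominates (Heavy H T) s t ∨ Dominates (Heavy H T) t s)) ∨
    (heavyCount H T s t ≤ 7 ∧ ∃ x y, IsCenter (Heavy H T) s t x y) := by
  rcases bipartite_trichotomy (hT.isYSet s hs).1 (hT.isYSet t ht).1
    (hT.no_three_matching h3 hs ht hst) with h | ⟨h, h'⟩ | h
  · exact Or.inl h
  · exact Or.inr (Or.inl ⟨h, h'.imp_right dominates_heavy_swap⟩)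
  · exact Or.inr (Or.inr h)

section Counting

open Classical

/-- The ordered pairs of distinct members of `T` spanning at most six heavy pairs. -/
noncomputable def sparse (H T : Finset (Finset α)) : Finset (Finset α × Finset α) :=
  (T ×ˢ T).filter fun e => e.1 ≠ e.2 ∧ heavyCount H T e.1 e.2 ≤ 6

theorem IsMaxPacking.sum_dominates_le {H T : Finset (Finset α)} (h3 : ∀ e ∈ H, e.card = 3)
    (hT : IsMaxPacking H T) (k : ℕ) :
    ∑ s ∈ T, ∑ t ∈ T, (if s ≠ t ∧ Dominates (Heavy H T) s t then k else 0) ≤ T.card * k := by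
  rw [Finset.sum_comm]
  refine Finset.sum_le_card_nsmul _ _ _ fun t ht => ?_
  rw [← Finset.sum_filter, Finset.sum_const, smul_eq_mul]
  have : (T.filter fun s => s ≠ t ∧ Dominates (Heavy H T) s t).card ≤ 1 := by
    rw [Finset.card_le_one]
    intro s hs w hw
    rw [Finset.mem_filter] at hs hw
    exact hT.dominates_unique h3 hs.1 ht hw.1 hs.2.1 hw.2.1 hs.2.2 hw.2.2
  calc _ ≤ 1 * k := Nat.mul_le_mul_right _ this
    _ = k := one_mul k

theorem sum_sparse (H T : Finset (Finset α)) (k : ℕ) :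
    ∑ s ∈ T, ∑ t ∈ T, (if s ≠ t ∧ heavyCount H T s t ≤ 6 then k else 0) =
      (sparse H T).card * k := by
  rw [← Finset.sum_product' T T fun s t => if s ≠ t ∧ heavyCount H T s t ≤ 6 then k else 0,
    ← Finset.sum_filter, Finset.sum_const, smul_eq_mul]
  rfl

theorem IsMaxPacking.sum_link_cover_le {H T : Finset (Finset α)} (h3 : ∀ e ∈ H, e.card = 3)
    (hT : IsMaxPacking H T) :
    (∑ s ∈ T, ∑ t ∈ T, ∑ p ∈ s, ∑ q ∈ t, (link H (free T) p q).card) +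
      (sparse H T).card * (free T).card ≤
    7 * T.card ^ 2 * (free T).card + 112 * T.card ^ 2 + 11 * T.card * (free T).card := by
  set u := (free T).card with hu
  have hpt : ∀ s ∈ T, ∀ t ∈ T, (∑ p ∈ s, ∑ q ∈ t, (link H (free T) p q).card) +
      (if s ≠ t ∧ heavyCount H T s t ≤ 6 then u else 0) ≤ (7 * u + 112) +
      (if s = t then 9 * u else 0) + (if s ≠ t ∧ Dominates (Heavy H T) s t then u else 0) +
      (if t ≠ s ∧ Dominates (Heavy H T) t s then u else 0) := by
    intro s hs t ht
    have hs4 := (hT.isYSet s hs).1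
    have ht4 := (hT.isYSet t ht).1
    have h1 := sum_link_le (H := H) (T := T) hs4 ht4
    rw [← hu] at h1
    by_cases hst : s = t
    · have h16 : heavyCount H T s t ≤ 16 := by
        refine (Finset.card_filter_le _ _).trans ?_
        simp [hs4, ht4]
      have := Nat.mul_le_mul_right u h16
      simp only [hst, ne_eq, not_true_eq_false, false_and, if_false, if_true] at *
      omega
    · have hts : t ≠ s := Ne.symm hst
      simp only [ne_eq, hst, hts, not_false_eq_true, true_and, if_false]
      rcases hT.trichotomy h3 hs ht hst with h | ⟨h, hd | hd⟩ | ⟨h, -⟩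
      · have := Nat.mul_le_mul_right u h
        split_ifs <;> omega
      · have := Nat.mul_le_mul_right u h
        by_cases h6 : heavyCount H T s t ≤ 6
        · have := Nat.mul_le_mul_right u h6
          split_ifs <;> omega
        · simp only [h6, hd, if_true, if_false]
          split_ifs <;> omega
      · have := Nat.mul_le_mul_right u h
        by_cases h6 : heavyCount H T s t ≤ 6
        · have := Nat.mul_le_mul_right u h6
          split_ifs <;> omega
        · simp only [h6, hd, if_true, if_false]
          split_ifs <;> omega
      · have := Nat.mul_le_mul_right u h
        by_cases h6 : heavyCount H T s t ≤ 6
        · have := Nat.mul_le_mul_right u h6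
          split_ifs <;> omega
        · split_ifs <;> omega
  have hsum := Finset.sum_le_sum fun s hs => Finset.sum_le_sum fun t ht => hpt s hs t ht
  simp only [Finset.sum_add_distrib] at hsum
  rw [sum_sparse, Finset.sum_comm (f := fun s t => if t ≠ s ∧ Dominates (Heavy H T) t s
    then u else 0)] at hsum
  have h1 := hT.sum_dominates_le h3 u
  have h2 : ∑ s ∈ T, ∑ t ∈ T, (if s = t then 9 * u else 0) = T.card * (9 * u) := by
    rw [← smul_eq_mul (a := T.card), ← Finset.sum_const]
    refine Finset.sum_congr rfl fun s hs => ?_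
    rw [Finset.sum_ite_eq, if_pos hs]
  rw [h2] at hsum
  simp only [Finset.sum_const, smul_eq_mul] at hsum
  nlinarith

theorem two_mul_hdeg_le {H : Finset (Finset α)} (h3 : ∀ e ∈ H, e.card = 3) (x : α) :
    2 * hdeg H x ≤ ∑ p, ∑ q, if ({x, p, q} : Finset α) ∈ H then 1 else 0 := by
  rw [← Finset.sum_product' Finset.univ Finset.univ
    fun p q => if ({x, p, q} : Finset α) ∈ H then 1 else 0, ← Finset.card_filter, hdeg]
  set S := (Finset.univ ×ˢ Finset.univ : Finset (α × α)).filter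
    fun e => ({x, e.1, e.2} : Finset α) ∈ H with hS
  refine Finset.mul_card_image_le_card_of_maps_to
    (f := fun e : α × α => ({x, e.1, e.2} : Finset α)) ?_ 2 ?_
  · rintro ⟨p, q⟩ he
    exact Finset.mem_filter.2 ⟨(Finset.mem_filter.1 he).2, by simp⟩
  · intro e he
    rw [Finset.mem_filter] at he
    have hcard : (e.erase x).card = 2 := by rw [Finset.card_erase_of_mem he.2, h3 e he.1]
    obtain ⟨p, q, hpq, hepq⟩ := Finset.card_eq_two.1 hcard
    have he' : ({x, p, q} : Finset α) = e := by rw [← hepq, Finset.insert_erase he.2]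
    have he'' : ({x, q, p} : Finset α) = e := by rw [Finset.pair_comm q p, he']
    rw [← Finset.card_pair (a := (p, q)) (b := (q, p)) (by simp [hpq])]
    refine Finset.card_le_card fun z hz => ?_
    rw [Finset.mem_insert, Finset.mem_singleton] at hz
    rcases hz with rfl | rfl <;> simp [hS, he', he'', he.1]

theorem sum_univ_eq (T : Finset (Finset α)) (hT : (T : Set (Finset α)).PairwiseDisjoint id)
    (f : α → ℕ) : ∑ p, f p = ∑ p ∈ free T, f p + ∑ s ∈ T, ∑ p ∈ s, f p := by
  rw [← Finset.sum_add_sum_compl (T.biUnion id) f, Finset.sum_biUnion hT, add_comm]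
  rfl

theorem IsMaxPacking.degree_sum_le {H T : Finset (Finset α)} (h3 : ∀ e ∈ H, e.card = 3)
    (hT : IsMaxPacking H T) :
    2 * (∑ x ∈ free T, hdeg H x) + (sparse H T).card * (free T).card ≤
      (free T).card ^ 2 + 2 * T.card * ((free T).card ^ 2 + 28 * (free T).card) +
      7 * T.card ^ 2 * (free T).card + 112 * T.card ^ 2 + 11 * T.card * (free T).card := by
  set U := free T with hU
  have h1 : 2 * (∑ x ∈ U, hdeg H x) ≤ ∑ p, ∑ q, (link H U p q).card := by
    rw [Finset.mul_sum]
    calc ∑ x ∈ U, 2 * hdeg H x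
        ≤ ∑ x ∈ U, ∑ p, ∑ q, (if ({x, p, q} : Finset α) ∈ H then 1 else 0) :=
          Finset.sum_le_sum fun x _ => two_mul_hdeg_le h3 x
      _ = ∑ p, ∑ q, (link H U p q).card := by
          rw [Finset.sum_comm]
          refine Finset.sum_congr rfl fun p _ => ?_
          rw [Finset.sum_comm]
          refine Finset.sum_congr rfl fun q _ => ?_
          rw [link, Finset.card_filter]
  have h2 : ∑ p, ∑ q, (link H U p q).card =
      ∑ p ∈ U, ∑ q ∈ U, (link H U p q).card +
      2 * (∑ s ∈ T, ∑ q ∈ s, ∑ p ∈ U, (link H U p q).card) +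
      ∑ s ∈ T, ∑ t ∈ T, ∑ p ∈ s, ∑ q ∈ t, (link H U p q).card := by
    rw [sum_univ_eq T hT.disj]
    simp only [sum_univ_eq T hT.disj (fun q => (link H U _ q).card), Finset.sum_add_distrib]
    have e1 : ∑ p ∈ U, ∑ s ∈ T, ∑ q ∈ s, (link H U p q).card =
        ∑ s ∈ T, ∑ q ∈ s, ∑ p ∈ U, (link H U p q).card := by
      rw [Finset.sum_comm]
      exact Finset.sum_congr rfl fun s _ => Finset.sum_comm
    have e2 : ∑ s ∈ T, ∑ p ∈ s, ∑ q ∈ U, (link H U p q).card =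
        ∑ s ∈ T, ∑ q ∈ s, ∑ p ∈ U, (link H U p q).card := by
      simp only [fun p q => link_comm H U p q]
    have e3 : ∑ s ∈ T, ∑ p ∈ s, ∑ t ∈ T, ∑ q ∈ t, (link H U p q).card =
        ∑ s ∈ T, ∑ t ∈ T, ∑ p ∈ s, ∑ q ∈ t, (link H U p q).card :=
      Finset.sum_congr rfl fun s _ => Finset.sum_comm
    rw [← hU, e1, e2, e3]
    ring
  have h4 : ∑ p ∈ U, ∑ q ∈ U, (link H U p q).card ≤ U.card ^ 2 := by
    rw [sq]
    refine Finset.sum_le_card_nsmul _ _ _ fun p hp => ?_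
    refine (Finset.sum_le_card_nsmul _ _ 1 fun q hq => hT.card_link_le_one h3 hp hq).trans ?_
    simp [hU]
  have h5 : ∑ s ∈ T, ∑ q ∈ s, ∑ p ∈ U, (link H U p q).card ≤
      T.card * (U.card ^ 2 + 28 * U.card) :=
    Finset.sum_le_card_nsmul _ _ _ fun s hs => hT.sum_link_free_le h3 hs
  have h6 := hT.sum_link_cover_le h3
  rw [← hU] at h6
  nlinarith

/-- The ordered pairs of members of `T` that do not span a double star of heavy pairs. -/
noncomputable def badPairs (H T : Finset (Finset α)) : Finset (Finset α × Finset α) :=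
  (T ×ˢ T).filter fun e => e.1 = e.2 ∨ ¬ ∃ x y, IsCenter (Heavy H T) e.1 e.2 x y

theorem IsMaxPacking.card_badPairs_le {H T : Finset (Finset α)} (h3 : ∀ e ∈ H, e.card = 3)
    (hT : IsMaxPacking H T) : (badPairs H T).card ≤ 3 * T.card + (sparse H T).card := by
  have hpt : ∀ s ∈ T, ∀ t ∈ T,
      (if s = t ∨ ¬ ∃ x y, IsCenter (Heavy H T) s t x y then 1 else 0) ≤
      (if s = t then 1 else 0) + (if s ≠ t ∧ heavyCount H T s t ≤ 6 then 1 else 0) +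
      (if s ≠ t ∧ Dominates (Heavy H T) s t then 1 else 0) +
      (if t ≠ s ∧ Dominates (Heavy H T) t s then 1 else 0) := by
    intro s hs t ht
    by_cases hst : s = t
    · simp only [hst, true_or, if_true]
      omega
    · have hts : t ≠ s := Ne.symm hst
      rcases hT.trichotomy h3 hs ht hst with h | ⟨-, hd | hd⟩ | ⟨-, h⟩
      · simp only [hst, h, ne_eq, not_false_eq_true, true_and, if_true, false_or]
        split_ifs <;> omega
      · simp only [hst, hd, ne_eq, not_false_eq_true, true_and, if_true, false_or]
        split_ifs <;> omega
      · simp only [hst, hts, hd, ne_eq, not_false_eq_true, true_and, if_true, false_or]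
        split_ifs <;> omega
      · simp [hst, h]
  have hsum := Finset.sum_le_sum fun s hs => Finset.sum_le_sum fun t ht => hpt s hs t ht
  simp only [Finset.sum_add_distrib] at hsum
  rw [sum_sparse, Finset.sum_comm (f := fun s t => if t ≠ s ∧ Dominates (Heavy H T) t s
    then 1 else 0), ← Finset.sum_product' T T fun s t =>
      if s = t ∨ ¬ ∃ x y, IsCenter (Heavy H T) s t x y then 1 else 0,
    ← Finset.card_filter] at hsum
  have h1 := hT.sum_dominates_le h3 1
  have h2 : ∑ s ∈ T, ∑ t ∈ T, (if s = t then 1 else 0) = T.card := by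
    rw [Finset.card_eq_sum_ones]
    refine Finset.sum_congr rfl fun s hs => ?_
    rw [Finset.sum_ite_eq, if_pos hs]
  rw [h2] at hsum
  unfold badPairs
  omega

theorem IsMaxPacking.exists_center [Nonempty α] {H T : Finset (Finset α)} (h3 : ∀ e ∈ H, e.card = 3)
    (hT : IsMaxPacking H T) : ∃ c : Finset α → α, ∀ s ∈ T, c s ∈ s ∧
      ∀ t ∈ T, s ≠ t → ∀ x y, IsCenter (Heavy H T) s t x y → x = c s := by
  have : ∀ s : Finset α, ∃ v : α, s ∈ T → v ∈ s ∧
      ∀ t ∈ T, s ≠ t → ∀ x y, IsCenter (Heavy H T) s t x y → x = v := by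
    intro s
    by_cases hex : s ∈ T ∧ ∃ t ∈ T, s ≠ t ∧ ∃ x y, IsCenter (Heavy H T) s t x y
    · obtain ⟨hs, t, ht, hst, x, y, hc⟩ := hex
      refine ⟨x, fun _ => ⟨hc.1, fun w hw hsw x' y' hc' => ?_⟩⟩
      exact hT.center_unique h3 hs hw ht hsw hst hc' hc
    · by_cases hs : s ∈ T
      · obtain ⟨-, a, b, c, d, rfl, -⟩ := hT.isYSet s hs
        exact ⟨a, fun _ => ⟨by simp, fun t ht hst x y hc => absurd ⟨hs, t, ht, hst, x, y, hc⟩ hex⟩⟩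
      · exact ⟨Classical.arbitrary α, fun h => absurd h hs⟩
  choose c hc using this
  exact ⟨c, hc⟩

/-- The ordered pairs of vertices lying in a bad pair of members of `T`. -/
noncomputable def badVertexPairs (H T : Finset (Finset α)) : Finset (α × α) :=
  (badPairs H T).biUnion fun e => e.1 ×ˢ e.2

theorem IsPacking.card_badVertexPairs_le {H T : Finset (Finset α)} (hT : IsPacking H T) :
    (badVertexPairs H T).card ≤ (badPairs H T).card * 16 := by
  refine Finset.card_biUnion_le_card_mul _ _ _ fun e he => ?_
  obtain ⟨h1, h2⟩ := Finset.mem_product.1 (Finset.mem_filter.1 he).1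
  rw [Finset.card_product, (hT.isYSet _ h1).1, (hT.isYSet _ h2).1]

theorem exists_isCenter_of_notMem {H T : Finset (Finset α)} {a b : α} {s t : Finset α}
    (hs : s ∈ T) (ht : t ∈ T) (ha : a ∈ s) (hb : b ∈ t) (hab : (a, b) ∉ badVertexPairs H T) :
    s ≠ t ∧ ∃ x y, IsCenter (Heavy H T) s t x y := by
  by_contra hcon
  refine hab (Finset.mem_biUnion.2 ⟨(s, t), Finset.mem_filter.2
    ⟨Finset.mem_product.2 ⟨hs, ht⟩, ?_⟩, Finset.mem_product.2 ⟨ha, hb⟩⟩)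
  simp only
  tauto

/-- The ordered edges in `B` with all three vertices covered by `T` and no bad pair. -/
noncomputable def cleanTriples (H T : Finset (Finset α)) (B : Finset α) : Finset (α × α × α) :=
  Finset.univ.filter fun e => ({e.1, e.2.1, e.2.2} : Finset α) ∈ H ∧
    (e.1 ∈ B ∧ e.2.1 ∈ B ∧ e.2.2 ∈ B) ∧
    (e.1 ∉ free T ∧ e.2.1 ∉ free T ∧ e.2.2 ∉ free T) ∧
    (e.1, e.2.1) ∉ badVertexPairs H T ∧ (e.1, e.2.2) ∉ badVertexPairs H T ∧
    (e.2.1, e.2.2) ∉ badVertexPairs H T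

theorem IsMaxPacking.card_cleanTriples_le {H T : Finset (Finset α)} (h3 : ∀ e ∈ H, e.card = 3)
    (hT : IsMaxPacking H T) {c : Finset α → α}
    (hc : ∀ s ∈ T, c s ∈ s ∧ ∀ t ∈ T, s ≠ t → ∀ x y, IsCenter (Heavy H T) s t x y → x = c s)
    {B : Finset α} (hB : ∀ v ∈ B, ∀ s ∈ T, v ∈ s → v ≠ c s) :
    (cleanTriples H T B).card ≤ 4 * Fintype.card α ^ 2 := by
  have hfiber : ∀ e ∈ (cleanTriples H T B).image Prod.snd,
      ((cleanTriples H T B).filter fun f => f.2 = e).card ≤ 4 := by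
    rintro ⟨v, w⟩ -
    by_contra! hlt
    set F := (cleanTriples H T B).filter fun f => f.2 = (v, w) with hF
    have hinj : (F.image Prod.fst).card = F.card := by
      refine Finset.card_image_of_injOn ?_
      rintro ⟨a, a'⟩ ha ⟨b, b'⟩ hb hab
      have h1 := (Finset.mem_filter.1 ha).2
      have h2 := (Finset.mem_filter.1 hb).2
      simp only at h1 h2 hab
      rw [h1, h2, hab]
    have hmem : ∀ a ∈ F.image Prod.fst, (a, v, w) ∈ cleanTriples H T B := by
      intro a ha
      obtain ⟨⟨a', e⟩, hf, rfl⟩ := Finset.mem_image.1 ha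
      obtain ⟨h1, h2⟩ := Finset.mem_filter.1 hf
      simp only at h2
      rwa [h2] at h1
    obtain ⟨a, ha⟩ := Finset.card_pos.1 (by omega : 0 < (F.image Prod.fst).card)
    have ha' := hmem a ha
    simp only [cleanTriples, Finset.mem_filter, Finset.mem_univ, true_and, mem_free, not_forall,
      not_not] at ha'
    obtain ⟨hE, ⟨haB, hvB, hwB⟩, ⟨⟨s₁, hs₁, has⟩, ⟨s₂, hs₂, hvs⟩, s₃, hs₃, hws⟩,
      hav, haw, hvw⟩ := ha'
    obtain ⟨d, hd, hds⟩ := Finset.exists_mem_notMem_of_card_lt_card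
      (by rw [(hT.isYSet s₁ hs₁).1]; omega : s₁.card < (F.image Prod.fst).card)
    have hd' := hmem d hd
    simp only [cleanTriples, Finset.mem_filter, Finset.mem_univ, true_and, mem_free, not_forall,
      not_not] at hd'
    obtain ⟨hE', ⟨hdB, -, -⟩, ⟨⟨s₄, hs₄, hds₄⟩, -, -⟩, hdv, hdw, -⟩ := hd'
    obtain ⟨n12, x₁, x₂, hc12⟩ := exists_isCenter_of_notMem hs₁ hs₂ has hvs hav
    obtain ⟨n13, -⟩ := exists_isCenter_of_notMem hs₁ hs₃ has hws haw
    obtain ⟨n23, -⟩ := exists_isCenter_of_notMem hs₂ hs₃ hvs hws hvw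
    obtain ⟨n42, -⟩ := exists_isCenter_of_notMem hs₄ hs₂ hds₄ hvs hdv
    obtain ⟨n43, x₄, x₃, hc43⟩ := exists_isCenter_of_notMem hs₄ hs₃ hds₄ hws hdw
    have n14 : s₁ ≠ s₄ := by
      rintro rfl
      exact hds hds₄
    have e1 := (hc s₁ hs₁).2 s₂ hs₂ n12 _ _ hc12
    have e2 := (hc s₂ hs₂).2 s₁ hs₁ n12.symm _ _ hc12.heavy_symm
    have e3 := (hc s₃ hs₃).2 s₄ hs₄ n43.symm _ _ hc43.heavy_symm
    have e4 := (hc s₄ hs₄).2 s₃ hs₃ n43 _ _ hc43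
    refine hT.no_crossing_isYSet h3 hs₁ hs₂ hs₃ hs₄ n12 n13 n14 n23 n42.symm n43.symm hc12
      hc43.heavy_symm has hvs hws hds₄ (e1 ▸ hB a haB s₁ hs₁ has) (e2 ▸ hB v hvB s₂ hs₂ hvs)
      (e3 ▸ hB w hwB s₃ hs₃ hws) (e4 ▸ hB d hdB s₄ hs₄ hds₄) hE ?_
    convert hE' using 1
    ext z; simp; tauto
  refine (Finset.card_le_mul_card_image _ 4 hfiber).trans (Nat.mul_le_mul_left _ ?_)
  refine (Finset.card_le_univ _).trans ?_
  rw [Fintype.card_prod, sq]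

theorem IsMaxPacking.eIn_le {H T : Finset (Finset α)} (h3 : ∀ e ∈ H, e.card = 3)
    (hT : IsMaxPacking H T) {c : Finset α → α}
    (hc : ∀ s ∈ T, c s ∈ s ∧ ∀ t ∈ T, s ≠ t → ∀ x y, IsCenter (Heavy H T) s t x y → x = c s)
    {B : Finset α} (hB : ∀ v ∈ B, ∀ s ∈ T, v ∈ s → v ≠ c s) :
    eIn H B ≤ 3 * ((free T).card * Fintype.card α ^ 2) +
      3 * ((badPairs H T).card * 16 * Fintype.card α) + 4 * Fintype.card α ^ 2 := by
  set U := free T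
  set P := badVertexPairs H T
  let V : Finset α := Finset.univ
  have hsub : H.filter (fun e => e ⊆ B) ⊆
      (((U ×ˢ V ×ˢ V) ∪ (V ×ˢ U ×ˢ V) ∪ (V ×ˢ V ×ˢ U)) ∪
      ((P ×ˢ V).image (fun e => (e.1.1, e.1.2, e.2)) ∪
        (P ×ˢ V).image (fun e => (e.1.1, e.2, e.1.2)) ∪ (P ×ˢ V).image (fun e => (e.2, e.1))) ∪
      cleanTriples H T B).image fun e : α × α × α => ({e.1, e.2.1, e.2.2} : Finset α) := by
    intro e he
    obtain ⟨heH, heB⟩ := Finset.mem_filter.1 he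
    obtain ⟨x, y, z, -, -, -, rfl⟩ := Finset.card_eq_three.1 (h3 e heH)
    refine Finset.mem_image.2 ⟨(x, y, z), ?_, rfl⟩
    have hx : x ∈ B := heB (by simp)
    have hy : y ∈ B := heB (by simp)
    have hz : z ∈ B := heB (by simp)
    by_cases hxU : x ∈ U
    · simp [V, hxU]
    by_cases hyU : y ∈ U
    · simp [V, hyU]
    by_cases hzU : z ∈ U
    · simp [V, hzU]
    by_cases hxy : (x, y) ∈ P
    · simp [V, hxy]
    by_cases hxz : (x, z) ∈ P
    · simp [V, hxz]
    by_cases hyz : (y, z) ∈ P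
    · simp [V, hyz]
    refine Finset.mem_union_right _ (Finset.mem_filter.2 ⟨Finset.mem_univ _, ?_⟩)
    exact ⟨heH, ⟨hx, hy, hz⟩, ⟨hxU, hyU, hzU⟩, hxy, hxz, hyz⟩
  have hP : (P ×ˢ V).card ≤ (badPairs H T).card * 16 * Fintype.card α := by
    rw [Finset.card_product]
    exact Nat.mul_le_mul_right _ hT.card_badVertexPairs_le
  have hclean := hT.card_cleanTriples_le h3 hc hB
  have hV : V.card = Fintype.card α := rfl
  have hU : (U ×ˢ V ×ˢ V).card + (V ×ˢ U ×ˢ V).card + (V ×ˢ V ×ˢ U).card =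
      3 * (U.card * Fintype.card α ^ 2) := by
    simp only [Finset.card_product, hV]
    ring
  refine (Finset.card_le_card hsub).trans (Finset.card_image_le.trans ?_)
  have i1 := (Finset.card_image_le (s := P ×ˢ V) (f := fun e => (e.1.1, e.1.2, e.2)))
  have i2 := (Finset.card_image_le (s := P ×ˢ V) (f := fun e => (e.1.1, e.2, e.1.2)))
  have i3 := (Finset.card_image_le (s := P ×ˢ V) (f := fun e => (e.2, e.1)))
  refine (Finset.card_union_le _ _).trans (Nat.add_le_add ?_ hclean)
  refine (Finset.card_union_le _ _).trans (Nat.add_le_add ?_ ?_)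
  · rw [← hU]
    refine (Finset.card_union_le _ _).trans (Nat.add_le_add_right ?_ _)
    exact Finset.card_union_le _ _
  · refine (Finset.card_union_le _ _).trans ?_
    have := Finset.card_union_le ((P ×ˢ V).image (fun e => (e.1.1, e.1.2, e.2)))
      ((P ×ˢ V).image (fun e => (e.1.1, e.2, e.1.2)))
    omega

theorem exists_isMaxPacking (H : Finset (Finset α)) : ∃ T, IsMaxPacking H T := by
  obtain ⟨T, hT, hmax⟩ := Finset.exists_max_image
    (Finset.univ.filter fun T : Finset (Finset α) => IsPacking H T) Finset.card
    ⟨∅, by simpa using IsPacking.empty H⟩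
  exact ⟨T, (Finset.mem_filter.1 hT).2, fun T' hT' => hmax T' (by simpa using hT')⟩

theorem IsPacking.card_free {H T : Finset (Finset α)} (hT : IsPacking H T) :
    4 * T.card + (free T).card = Fintype.card α := by
  rw [← hT.card_biUnion, free, Finset.card_add_card_compl]

/-- Some set of `⌊3n/4⌋` vertices avoids one prescribed vertex from each member. -/
theorem IsPacking.exists_avoiding {H T : Finset (Finset α)} (hT : IsPacking H T)
    (c : Finset α → α) :
    ∃ B : Finset α, B.card = 3 * Fintype.card α / 4 ∧ ∀ v ∈ B, ∀ s ∈ T, v ∈ s → v ≠ c s := by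
  have hle : 3 * Fintype.card α / 4 ≤ (T.image c)ᶜ.card := by
    have h1 := Finset.card_add_card_compl (T.image c)
    have h2 := Finset.card_image_le (s := T) (f := c)
    have h3 := hT.card_free
    omega
  obtain ⟨B, hB, hcard⟩ := Finset.exists_subset_card_eq hle
  refine ⟨B, hcard, fun v hv s hs _ h => ?_⟩
  have := hB hv
  rw [Finset.mem_compl] at this
  exact this (Finset.mem_image.2 ⟨s, hs, h.symm⟩)

end Counting

end YTiling

/-- The degree count forces few sparse pairs and few uncovered vertices. -/
theorem YTiling.sparse_free_bounds {γ : ℝ} {n m u b S : ℕ} (hγ : 0 < γ) (hγn : 100 < γ * n)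
    (hn : (n : ℝ) = 4 * m + u) (hu : (2 : ℝ) ^ 19 < u * γ)
    (hlow : (u : ℝ) * ((7 / 16 - γ) * (n.choose 2 : ℝ)) ≤ S)
    (hup : 2 * (S : ℝ) + b * u ≤ (u : ℝ) ^ 2 + 2 * m * ((u : ℝ) ^ 2 + 28 * u) +
      7 * (m : ℝ) ^ 2 * u + 112 * (m : ℝ) ^ 2 + 11 * m * u) :
    (b : ℝ) ≤ 3 * γ * (n : ℝ) ^ 2 ∧ (u : ℝ) ≤ 8 * γ * n := by
  have hm0 : (0 : ℝ) ≤ m := Nat.cast_nonneg _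
  have hb0 : (0 : ℝ) ≤ b := Nat.cast_nonneg _
  have hu0 : (0 : ℝ) < u := by
    by_contra! h
    have := mul_nonpos_of_nonpos_of_nonneg h hγ.le
    linarith
  have hn0 : (0 : ℝ) < n := by linarith
  rw [Nat.cast_choose_two] at hlow
  have hdiv : (7 / 16 - γ) * ((n : ℝ) * (n - 1)) + b ≤
      u + 2 * m * u + 67 * m + 7 * (m : ℝ) ^ 2 + γ * (m : ℝ) ^ 2 := by
    refine le_of_mul_le_mul_left ?_ hu0
    have : 112 * (m : ℝ) ^ 2 ≤ u * γ * (m : ℝ) ^ 2 := by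
      gcongr
      linarith
    nlinarith
  have hlin : 100 * (n : ℝ) ≤ γ * (n : ℝ) ^ 2 := by nlinarith
  have hm2 : γ * (m : ℝ) ^ 2 ≤ γ * (n : ℝ) ^ 2 :=
    mul_le_mul_of_nonneg_left (pow_le_pow_left₀ hm0 (by linarith) 2) hγ.le
  have hγn' : 0 < γ * n := by positivity
  have hkey : b + 3 / 2 * (m * u) + 7 / 16 * (u : ℝ) ^ 2 ≤ 3 * γ * (n : ℝ) ^ 2 := by
    have : (n : ℝ) ^ 2 = 16 * (m : ℝ) ^ 2 + 8 * (m * u) + (u : ℝ) ^ 2 := by rw [hn]; ring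
    nlinarith
  have hmu : 0 ≤ (m : ℝ) * u := by positivity
  refine ⟨by nlinarith, ?_⟩
  refine le_of_mul_le_mul_right ?_ hn0
  have : (u : ℝ) * n = 4 * (m * u) + (u : ℝ) ^ 2 := by rw [hn]; ring
  nlinarith

/-- `𝒴`-tiling Lemma: under minimum vertex degree `(7/16 - γ) C(n,2)`, either there is a
`𝒴`-tiling covering all but at most `2¹⁹/γ` vertices, or `H` is `2¹⁰γ`-extremal. -/
theorem stmt_12 (γ : ℝ) (hγ : 0 < γ) :
    ∃ n₀ : ℕ, ∀ n : ℕ, n > n₀ →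
      ∀ H : Finset (Finset (Fin n)), (∀ e ∈ H, e.card = 3) →
      (∀ x : Fin n, (7 / 16 - γ) * (n.choose 2 : ℝ) ≤ (hdeg H x : ℝ)) →
      (∃ (m : ℕ) (f : Fin m → Fin 4 → Fin n), IsYTiling H m f ∧
        (n : ℝ) - 4 * m ≤ 2 ^ 19 / γ) ∨
      BetaExtremal (2 ^ 10 * γ) n H := by
  refine ⟨⌈100 / γ⌉₊, fun n hn H h3 hdeg => ?_⟩
  have hn0 : 0 < n := by omega
  have : Nonempty (Fin n) := ⟨⟨0, hn0⟩⟩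
  have hγn : 100 < γ * n := by
    have := (Nat.lt_of_ceil_lt hn)
    rw [div_lt_iff₀ hγ] at this
    linarith
  obtain ⟨T, hT⟩ := YTiling.exists_isMaxPacking H
  have hcard := hT.card_free
  rw [Fintype.card_fin] at hcard
  have hnR : (n : ℝ) = 4 * T.card + (YTiling.free T).card := by exact_mod_cast hcard.symm
  by_cases hu : (n : ℝ) - 4 * T.card ≤ 2 ^ 19 / γ
  · obtain ⟨f, hf⟩ := hT.exists_isYTiling
    exact Or.inl ⟨_, f, hf, hu⟩
  refine Or.inr ?_
  rw [hnR, add_sub_cancel_left, not_le, div_lt_iff₀ hγ] at hu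
  have hsum : ((YTiling.free T).card : ℝ) * ((7 / 16 - γ) * (n.choose 2 : ℝ)) ≤
      ((∑ x ∈ YTiling.free T, _root_.hdeg H x : ℕ) : ℝ) := by
    push_cast
    rw [← nsmul_eq_mul]
    exact Finset.card_nsmul_le_sum _ _ _ fun x _ => hdeg x
  obtain ⟨hb, hubound⟩ := YTiling.sparse_free_bounds hγ hγn hnR hu hsum
    (by exact_mod_cast hT.degree_sum_le h3)
  obtain ⟨c, hc⟩ := hT.exists_center h3
  obtain ⟨B, hBcard, hB⟩ := hT.exists_avoiding c
  have hE := hT.eIn_le h3 hc hB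
  have hbad := hT.card_badPairs_le h3
  rw [Fintype.card_fin] at hBcard hE
  refine ⟨B, hBcard, ?_⟩
  have hE' : (eIn H B : ℝ) ≤ 3 * ((YTiling.free T).card * (n : ℝ) ^ 2) +
      3 * ((YTiling.badPairs H T).card * 16 * n) + 4 * (n : ℝ) ^ 2 := by exact_mod_cast hE
  have hbad' : ((YTiling.badPairs H T).card : ℝ) ≤ n + 3 * γ * (n : ℝ) ^ 2 := by
    have : ((YTiling.badPairs H T).card : ℝ) ≤ 3 * T.card + (YTiling.sparse H T).card := by
      exact_mod_cast hbad
    have : (0 : ℝ) ≤ T.card := Nat.cast_nonneg _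
    have : (0 : ℝ) ≤ (YTiling.free T).card := Nat.cast_nonneg _
    linarith
  have hn2 : 100 * (n : ℝ) ^ 2 ≤ γ * n * (n : ℝ) ^ 2 := by gcongr
  calc (eIn H B : ℝ)
      ≤ 3 * ((8 * γ * n) * (n : ℝ) ^ 2) + 3 * ((n + 3 * γ * (n : ℝ) ^ 2) * 16 * n) +
        4 * (n : ℝ) ^ 2 := hE'.trans (by gcongr)
    _ ≤ 2 ^ 10 * γ * (n : ℝ) ^ 3 := by
      have : 0 < γ * (n : ℝ) ^ 3 := by positivity
      nlinarith
end

section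
/- For any γ > 0 there exists an integer n₀ such that the following holds. Suppose H is a 3-graph on n > n₀ vertices with δ₁(H) ≥ (7/16 − γ)·C(n,2). Then either there is a 𝒴-tiling in H covering all but at most 2¹⁹/γ vertices of H, or H contains a set of vertices of size at least (1 − 2¹¹γ)·(3/4)·n that contains no copy of 𝒴. -/
/-- `a, b, c, d` form a copy of `𝒴` (the 3-graph with edges `123`, `234`) in `H`. -/
def YCopy {α : Type*} [DecidableEq α] (H : Finset (Finset α)) (a b c d : α) : Prop :=
  ({a, b, c, d} : Finset α).card = 4 ∧
  ({a, b, c} : Finset α) ∈ H ∧ ({b, c, d} : Finset α) ∈ H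

/-- Disjoint four-element tiles with a graph `g` in which no short matching has more edges than
the number of tiles it meets. -/
structure IsTileGraph {α : Type*} [DecidableEq α] (P : Finset (Finset α))
    (g : α → α → Prop) : Prop where
  symm : ∀ x y, g x y → g y x
  card_eq : ∀ A ∈ P, A.card = 4
  disj : ∀ A ∈ P, ∀ B ∈ P, A ≠ B → ∀ x ∈ A, x ∉ B
  length_le : ∀ l : List (α × α), l.length ≤ 8 → (∀ p ∈ l, g p.1 p.2) →
    (l.flatMap fun p => [p.1, p.2]).Nodup → ∀ J ⊆ P,
    (∀ x ∈ l.flatMap fun p => [p.1, p.2], ∃ A ∈ J, x ∈ A) → l.length ≤ J.card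

/-- Two vertices of `A` send at least seven edges to the tile `B`. -/
def Dominates {α : Type*} (g : α → α → Prop) (A B : Finset α) : Prop :=
  ∃ a₁ ∈ A, ∃ a₂ ∈ A, a₁ ≠ a₂ ∧ (∀ b ∈ B, g a₂ b) ∧
    ∀ x y, ∃ b ∈ B, b ≠ x ∧ b ≠ y ∧ g a₁ b

/-- `c ∈ A` is joined to all of `B` and some vertex of `B` is joined to all of `A`. -/
def StarAt {α : Type*} (g : α → α → Prop) (A B : Finset α) (c : α) : Prop :=
  c ∈ A ∧ ∃ d ∈ B, (∀ b ∈ B, g c b) ∧ ∀ a ∈ A, g a d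

open Classical in
/-- The number of edges between `A` and `B`. -/
noncomputable def edgeCount {α : Type*} (g : α → α → Prop) (A B : Finset α) : ℕ :=
  ((A ×ˢ B).filter fun p => g p.1 p.2).card

theorem exists_mem_ne_of_card {α : Type*} [DecidableEq α] {B : Finset α} (hB : B.card = 4)
    (x y z : α) : ∃ b ∈ B, b ≠ x ∧ b ≠ y ∧ b ≠ z := by
  have h : ¬ B ⊆ {x, y, z} := fun h => by
    have := Finset.card_le_card h
    have := Finset.card_le_three (a := x) (b := y) (c := z)
    omega
  obtain ⟨b, hb, hne⟩ := Finset.not_subset.mp h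
  simp only [Finset.mem_insert, Finset.mem_singleton, not_or] at hne
  exact ⟨b, hb, hne⟩

/-- A bipartite graph between two four-element sets without three disjoint edges has a vertex
cover of size two. -/
theorem exists_cover_of_no_three_matching {α : Type*} [DecidableEq α] {g : α → α → Prop}
    {A B : Finset α} (hA : A.card = 4) (hB : B.card = 4)
    (h3 : ∀ a₁ ∈ A, ∀ a₂ ∈ A, ∀ a₃ ∈ A, ∀ b₁ ∈ B, ∀ b₂ ∈ B, ∀ b₃ ∈ B, a₁ ≠ a₂ → a₁ ≠ a₃ →
      a₂ ≠ a₃ → b₁ ≠ b₂ → b₁ ≠ b₃ → b₂ ≠ b₃ → g a₁ b₁ → g a₂ b₂ → g a₃ b₃ → False) :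
    (∃ a₁ ∈ A, ∃ a₂ ∈ A, a₁ ≠ a₂ ∧ ∀ a ∈ A, ∀ b ∈ B, g a b → a = a₁ ∨ a = a₂) ∨
    (∃ b₁ ∈ B, ∃ b₂ ∈ B, b₁ ≠ b₂ ∧ ∀ a ∈ A, ∀ b ∈ B, g a b → b = b₁ ∨ b = b₂) ∨
    (∃ c ∈ A, ∃ d ∈ B, ∀ a ∈ A, ∀ b ∈ B, g a b → a = c ∨ b = d) := by
  by_cases h1 : ∃ a₁ ∈ A, ∃ b₁ ∈ B, g a₁ b₁
  swap
  · obtain ⟨a, ha⟩ : A.Nonempty := Finset.card_pos.mp (by omega)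
    obtain ⟨b, hb⟩ : B.Nonempty := Finset.card_pos.mp (by omega)
    exact Or.inr (Or.inr ⟨a, ha, b, hb, fun a ha b hb h => (h1 ⟨a, ha, b, hb, h⟩).elim⟩)
  obtain ⟨a₁, ha₁, b₁, hb₁, e₁⟩ := h1
  by_cases h2 : ∃ a₂ ∈ A, ∃ b₂ ∈ B, a₂ ≠ a₁ ∧ b₂ ≠ b₁ ∧ g a₂ b₂
  swap
  · refine Or.inr (Or.inr ⟨a₁, ha₁, b₁, hb₁, fun a ha b hb h => ?_⟩)
    by_contra! hne
    exact h2 ⟨a, ha, b, hb, hne.1, hne.2, h⟩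
  obtain ⟨a₂, ha₂, b₂, hb₂, hna, hnb, e₂⟩ := h2
  have out : ∀ a ∈ A, ∀ b ∈ B, a ≠ a₁ → a ≠ a₂ → b ≠ b₁ → b ≠ b₂ → ¬ g a b :=
    fun a ha b hb p q r s h => h3 a₁ ha₁ a₂ ha₂ a ha b₁ hb₁ b₂ hb₂ b hb hna.symm p.symm q.symm
      hnb.symm r.symm s.symm e₁ e₂ h
  have aug₁ : ∀ a ∈ A, ∀ b ∈ B, a ≠ a₁ → a ≠ a₂ → b ≠ b₁ → b ≠ b₂ → g a b₁ → ¬ g a₁ b := by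
    intro a ha b hb p q r s h h'
    exact h3 a ha a₁ ha₁ a₂ ha₂ b₁ hb₁ b hb b₂ hb₂ p q hna.symm r.symm hnb.symm s h h' e₂
  have aug₂ : ∀ a ∈ A, ∀ b ∈ B, a ≠ a₁ → a ≠ a₂ → b ≠ b₁ → b ≠ b₂ → g a b₂ → ¬ g a₂ b := by
    intro a ha b hb p q r s h h'
    exact h3 a ha a₂ ha₂ a₁ ha₁ b₂ hb₂ b hb b₁ hb₁ q p hna s.symm hnb r h h' e₁
  have aug₁₂ : ∀ a ∈ A, ∀ b ∈ B, a ≠ a₁ → a ≠ a₂ → b ≠ b₁ → b ≠ b₂ → g a b₁ → g a₁ b₂ →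
      ¬ g a₂ b := by
    intro a ha b hb p q r s h h' h''
    exact h3 a ha a₁ ha₁ a₂ ha₂ b₁ hb₁ b₂ hb₂ b hb p q hna.symm hnb.symm r.symm s.symm h h' h''
  have aug₂₁ : ∀ a ∈ A, ∀ b ∈ B, a ≠ a₁ → a ≠ a₂ → b ≠ b₁ → b ≠ b₂ → g a b₂ → g a₂ b₁ →
      ¬ g a₁ b := by
    intro a ha b hb p q r s h h' h''
    exact h3 a ha a₂ ha₂ a₁ ha₁ b₂ hb₂ b₁ hb₁ b hb q p hna hnb s.symm r.symm h h' h''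
  by_contra! hcon
  obtain ⟨c1, c2, c3⟩ := hcon
  obtain ⟨p, hp, q, hq, e3, hp1, hp2⟩ := c1 a₁ ha₁ a₂ ha₂ hna.symm
  obtain ⟨r, hr, s, hs, e4, hs1, hs2⟩ := c2 b₁ hb₁ b₂ hb₂ hnb.symm
  obtain ⟨v, hv, w, hw, e5, hv1, hw1⟩ := c3 a₁ ha₁ b₂ hb₂
  obtain ⟨v', hv', w', hw', e6, hv2, hw2⟩ := c3 a₂ ha₂ b₁ hb₁
  have hq' : q = b₁ ∨ q = b₂ := by
    by_contra! h; exact out p hp q hq hp1 hp2 h.1 h.2 e3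
  have hr' : r = a₁ ∨ r = a₂ := by
    by_contra! h; exact out r hr s hs h.1 h.2 hs1 hs2 e4
  rcases hq' with rfl | rfl
  · have hra : r = a₂ := hr'.resolve_left fun hr₁ =>
      aug₁ p hp s hs hp1 hp2 hs1 hs2 e3 (hr₁ ▸ e4)
    subst hra
    by_cases h₁ : v' = a₁ <;> by_cases h₂ : w' = b₂
    · exact aug₁₂ p hp s hs hp1 hp2 hs1 hs2 e3 (h₁ ▸ h₂ ▸ e6) e4
    · exact aug₁ p hp w' hw' hp1 hp2 hw2 h₂ e3 (h₁ ▸ e6)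
    · exact aug₂ v' hv' s hs h₁ hv2 hs1 hs2 (h₂ ▸ e6) e4
    · exact out v' hv' w' hw' h₁ hv2 hw2 h₂ e6
  · have hra : r = a₁ := hr'.resolve_right fun hr₁ =>
      aug₂ p hp s hs hp1 hp2 hs1 hs2 e3 (hr₁ ▸ e4)
    subst hra
    by_cases h₁ : v = a₂ <;> by_cases h₂ : w = b₁
    · exact aug₂₁ p hp s hs hp1 hp2 hs1 hs2 e3 (h₁ ▸ h₂ ▸ e5) e4
    · exact aug₂ p hp w hw hp1 hp2 h₂ hw1 e3 (h₁ ▸ e5)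
    · exact aug₁ v hv s hs hv1 h₁ hs1 hs2 (h₂ ▸ e5) e4
    · exact out v hv w hw hv1 h₁ h₂ hw1 e5

theorem edgeCount_comm {α : Type*} {g : α → α → Prop} (hg : ∀ x y, g x y → g y x)
    (A B : Finset α) : edgeCount g A B = edgeCount g B A := by
  classical
  refine Finset.card_bij (fun p _ => (p.2, p.1)) ?_ ?_ ?_
  · intro p hp
    simp only [Finset.mem_filter, Finset.mem_product] at hp ⊢
    exact ⟨hp.1.symm, hg _ _ hp.2⟩
  · rintro ⟨a, b⟩ _ ⟨c, d⟩ _ h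
    simp only [Prod.mk.injEq] at h ⊢
    exact h.symm
  · rintro ⟨a, b⟩ h
    simp only [Finset.mem_filter, Finset.mem_product] at h
    refine ⟨(b, a), ?_, rfl⟩
    simp only [Finset.mem_filter, Finset.mem_product]
    exact ⟨h.1.symm, hg _ _ h.2⟩

theorem edgeCount_of_cover_left {α : Type*} [DecidableEq α] {g : α → α → Prop} {A B : Finset α}
    (hB : B.card = 4) {a₁ a₂ : α} (h₁ : a₁ ∈ A) (h₂ : a₂ ∈ A) (hne : a₁ ≠ a₂)
    (hcov : ∀ a ∈ A, ∀ b ∈ B, g a b → a = a₁ ∨ a = a₂) :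
    edgeCount g A B ≤ 8 ∧ (7 ≤ edgeCount g A B → Dominates g A B) := by
  classical
  have hd : ∀ a, (B.filter (g a)).card ≤ 4 := fun a => hB ▸ Finset.card_filter_le _ _
  have hle : edgeCount g A B ≤ (B.filter (g a₁)).card + (B.filter (g a₂)).card := by
    have hsub : ((A ×ˢ B).filter fun p => g p.1 p.2) ⊆
        (B.filter (g a₁)).image (Prod.mk a₁) ∪ (B.filter (g a₂)).image (Prod.mk a₂) := by
      rintro ⟨a, b⟩ h
      simp only [Finset.mem_filter, Finset.mem_product] at h
      simp only [Finset.mem_union, Finset.mem_image, Finset.mem_filter]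
      rcases hcov a h.1.1 b h.1.2 h.2 with rfl | rfl
      · exact Or.inl ⟨b, ⟨h.1.2, h.2⟩, rfl⟩
      · exact Or.inr ⟨b, ⟨h.1.2, h.2⟩, rfl⟩
    refine (Finset.card_le_card hsub).trans ((Finset.card_union_le _ _).trans ?_)
    exact Nat.add_le_add Finset.card_image_le Finset.card_image_le
  have key : ∀ a a' : α, a ∈ A → a' ∈ A → a ≠ a' → (B.filter (g a')).card = 4 →
      3 ≤ (B.filter (g a)).card → Dominates g A B := by
    intro a a' ha ha' hn h4 h3
    refine ⟨a, ha, a', ha', hn, ?_, fun x y => ?_⟩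
    · have : B.filter (g a') = B :=
        Finset.eq_of_subset_of_card_le (Finset.filter_subset _ _) (by omega)
      intro b hb
      rw [← this] at hb
      exact (Finset.mem_filter.mp hb).2
    · have h : ¬ B.filter (g a) ⊆ {x, y} := fun h => by
        have := Finset.card_le_card h
        have := Finset.card_le_two (a := x) (b := y)
        omega
      obtain ⟨b, hb, hb'⟩ := Finset.not_subset.mp h
      simp only [Finset.mem_insert, Finset.mem_singleton, not_or] at hb'
      exact ⟨b, (Finset.mem_filter.mp hb).1, hb'.1, hb'.2, (Finset.mem_filter.mp hb).2⟩
  have := hd a₁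
  have := hd a₂
  refine ⟨by omega, fun h7 => ?_⟩
  by_cases h4 : (B.filter (g a₂)).card = 4
  · exact key a₁ a₂ h₁ h₂ hne h4 (by omega)
  · exact key a₂ a₁ h₂ h₁ hne.symm (by omega) (by omega)

theorem edgeCount_of_cover_star {α : Type*} [DecidableEq α] {g : α → α → Prop} {A B : Finset α}
    (hA : A.card = 4) (hB : B.card = 4) {c d : α} (hc : c ∈ A) (hd : d ∈ B)
    (hcov : ∀ a ∈ A, ∀ b ∈ B, g a b → a = c ∨ b = d) :
    edgeCount g A B ≤ 7 ∧ (7 ≤ edgeCount g A B → StarAt g A B c) := by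
  classical
  set E := (A ×ˢ B).filter fun p => g p.1 p.2 with hE
  set F := ({c} : Finset α) ×ˢ B ∪ (A.erase c) ×ˢ {d} with hF
  have hsub : E ⊆ F := by
    rintro ⟨a, b⟩ h
    simp only [hE, Finset.mem_filter, Finset.mem_product] at h
    have := hcov a h.1.1 b h.1.2 h.2
    simp only [hF, Finset.mem_union, Finset.mem_product, Finset.mem_singleton, Finset.mem_erase]
    tauto
  have hcard : F.card ≤ 7 := by
    refine (Finset.card_union_le _ _).trans ?_
    rw [Finset.card_product, Finset.card_product, Finset.card_erase_of_mem hc, hA, hB]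
    simp
  refine ⟨(Finset.card_le_card hsub).trans hcard, fun h7 => ?_⟩
  have hEF : E = F := Finset.eq_of_subset_of_card_le hsub (hcard.trans h7)
  have hmem : ∀ a b, (a, b) ∈ F → g a b := fun a b h => by
    rw [← hEF] at h
    exact (Finset.mem_filter.mp h).2
  have hcB : ∀ b ∈ B, g c b := fun b hb => hmem c b (by simp [hF, hb])
  refine ⟨hc, d, hd, hcB, fun a ha => ?_⟩
  by_cases hac : a = c
  · exact hac ▸ hcB d hd
  · exact hmem a d (by simp [hF, ha, hac])

namespace IsTileGraph

variable {α : Type*} [DecidableEq α] {P : Finset (Finset α)} {g : α → α → Prop}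

theorem no_three (h : IsTileGraph P g) {A B : Finset α} (hA : A ∈ P) (hB : B ∈ P)
    {x₁ y₁ x₂ y₂ x₃ y₃ : α} (e₁ : g x₁ y₁) (e₂ : g x₂ y₂) (e₃ : g x₃ y₃)
    (hn : [x₁, y₁, x₂, y₂, x₃, y₃].Nodup)
    (hm : ∀ x ∈ [x₁, y₁, x₂, y₂, x₃, y₃], x ∈ A ∨ x ∈ B) : False := by
  have := h.length_le [(x₁, y₁), (x₂, y₂), (x₃, y₃)] (by simp) (by simp [e₁, e₂, e₃]) hn {A, B}
    (by simp [Finset.insert_subset_iff, hA, hB]) (by simpa using hm)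
  have := Finset.card_le_two (a := A) (b := B)
  simp only [List.length_cons, List.length_nil] at *
  omega

theorem no_four (h : IsTileGraph P g) {A B C : Finset α} (hA : A ∈ P) (hB : B ∈ P) (hC : C ∈ P)
    {x₁ y₁ x₂ y₂ x₃ y₃ x₄ y₄ : α} (e₁ : g x₁ y₁) (e₂ : g x₂ y₂) (e₃ : g x₃ y₃) (e₄ : g x₄ y₄)
    (hn : [x₁, y₁, x₂, y₂, x₃, y₃, x₄, y₄].Nodup)
    (hm : ∀ x ∈ [x₁, y₁, x₂, y₂, x₃, y₃, x₄, y₄], x ∈ A ∨ x ∈ B ∨ x ∈ C) : False := by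
  have := h.length_le [(x₁, y₁), (x₂, y₂), (x₃, y₃), (x₄, y₄)] (by simp)
    (by simp [e₁, e₂, e₃, e₄]) hn {A, B, C}
    (by simp [Finset.insert_subset_iff, hA, hB, hC]) (by simpa using hm)
  have := Finset.card_le_three (a := A) (b := B) (c := C)
  simp only [List.length_cons, List.length_nil] at *
  omega

theorem edgeCount_le (h : IsTileGraph P g) {A B : Finset α} (hA : A ∈ P) (hB : B ∈ P)
    (hAB : A ≠ B) : edgeCount g A B ≤ 8 ∧ (7 ≤ edgeCount g A B →
      Dominates g A B ∨ Dominates g B A ∨ (∃ c, StarAt g A B c) ∧ edgeCount g A B ≤ 7) := by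
  have hd := h.disj A hA B hB hAB
  have h4 := h.card_eq A hA
  have h4' := h.card_eq B hB
  rcases exists_cover_of_no_three_matching (g := g) h4 h4' (by
    intro a₁ ha₁ a₂ ha₂ a₃ ha₃ b₁ hb₁ b₂ hb₂ b₃ hb₃ n1 n2 n3 n4 n5 n6 e₁ e₂ e₃
    refine h.no_three hA hB e₁ e₂ e₃ ?_ ?_
    · simp only [List.nodup_cons, List.mem_cons, List.not_mem_nil, List.nodup_nil]
      grind (splits := 40)
    · simp [*]) with
    ⟨a₁, h₁, a₂, h₂, hne, hc⟩ | ⟨b₁, h₁, b₂, h₂, hne, hc⟩ | ⟨c, hc, d, hd, hcov⟩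
  · have := edgeCount_of_cover_left h4' h₁ h₂ hne hc
    exact ⟨this.1, fun h7 => Or.inl (this.2 h7)⟩
  · have := edgeCount_of_cover_left (g := g) h4 h₁ h₂ hne
      (fun b hb a ha hg => hc a ha b hb (h.symm _ _ hg))
    rw [edgeCount_comm h.symm B A] at this
    exact ⟨this.1, fun h7 => Or.inr (Or.inl (this.2 h7))⟩
  · have := edgeCount_of_cover_star h4 h4' hc hd hcov
    exact ⟨by omega, fun h7 => Or.inr (Or.inr ⟨⟨c, this.2 h7⟩, this.1⟩)⟩

theorem not_dominates_both (h : IsTileGraph P g) {A B : Finset α} (hA : A ∈ P) (hB : B ∈ P)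
    (hAB : A ≠ B) (h₁ : Dominates g A B) (h₂ : Dominates g B A) : False := by
  obtain ⟨a₁, ha₁, a₂, ha₂, hne, hall, hsome⟩ := h₁
  obtain ⟨b₁, hb₁, -, -, -, -, hsome'⟩ := h₂
  have hd := h.disj A hA B hB hAB
  obtain ⟨p, hp, hp₁, hp₂, ep⟩ := hsome' a₁ a₂
  obtain ⟨x, hx, hx₁, -, ex⟩ := hsome b₁ b₁
  obtain ⟨y, hy, hy₁, hy₂, -⟩ := exists_mem_ne_of_card (h.card_eq B hB) b₁ x x
  refine h.no_three hA hB ep ex (hall y hy) ?_ ?_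
  · simp only [List.nodup_cons, List.mem_cons, List.not_mem_nil, List.nodup_nil]
    grind (splits := 40)
  · simp [*]

theorem not_dominates_trans (h : IsTileGraph P g) {A B C : Finset α} (hA : A ∈ P) (hB : B ∈ P)
    (hC : C ∈ P) (hAB : A ≠ B) (hBC : B ≠ C) (h₁ : Dominates g A B) (h₂ : Dominates g B C) :
    False := by
  by_cases hAC : A = C
  · subst hAC
    exact h.not_dominates_both hA hB hAB h₁ h₂
  obtain ⟨a₁, ha₁, a₂, ha₂, hne, hall, hsome⟩ := h₁
  obtain ⟨b₁, hb₁, b₂, hb₂, hne', hall', hsome'⟩ := h₂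
  have d₁ := h.disj A hA B hB hAB
  have d₂ := h.disj A hA C hC hAC
  have d₃ := h.disj B hB C hC hBC
  obtain ⟨x, hx, hx₁, hx₂, ex⟩ := hsome b₁ b₂
  obtain ⟨y, hy, hy₁, hy₂, hy₃⟩ := exists_mem_ne_of_card (h.card_eq B hB) b₁ b₂ x
  obtain ⟨z, hz, -, -, ez⟩ := hsome' b₁ b₁
  obtain ⟨w, hw, hw₁, -, -⟩ := exists_mem_ne_of_card (h.card_eq C hC) z z z
  refine h.no_four hA hB hC ex (hall y hy) ez (hall' w hw) ?_ ?_
  · simp only [List.nodup_cons, List.mem_cons, List.not_mem_nil, List.nodup_nil]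
    grind (splits := 40)
  · simp [*]

theorem not_star_of_dominates (h : IsTileGraph P g) {A B C : Finset α} {c : α} (hA : A ∈ P)
    (hB : B ∈ P) (hC : C ∈ P) (hAB : A ≠ B) (hAC : A ≠ C) (hBC : B ≠ C)
    (h₁ : Dominates g A B) (h₂ : StarAt g B C c) : False := by
  obtain ⟨a₁, ha₁, a₂, ha₂, hne, hall, hsome⟩ := h₁
  obtain ⟨hc, d, hd, hcC, hdB⟩ := h₂
  have d₁ := h.disj A hA B hB hAB
  have d₂ := h.disj A hA C hC hAC
  have d₃ := h.disj B hB C hC hBC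
  obtain ⟨x, hx, hx₁, -, ex⟩ := hsome c c
  obtain ⟨y, hy, hy₁, hy₂, -⟩ := exists_mem_ne_of_card (h.card_eq B hB) c x x
  obtain ⟨z, hz, hz₁, hz₂, hz₃⟩ := exists_mem_ne_of_card (h.card_eq B hB) c x y
  obtain ⟨w, hw, hw₁, -, -⟩ := exists_mem_ne_of_card (h.card_eq C hC) d d d
  refine h.no_four hA hB hC ex (hall y hy) (hdB z hz) (hcC w hw) ?_ ?_
  · simp only [List.nodup_cons, List.mem_cons, List.not_mem_nil, List.nodup_nil]
    grind (splits := 40)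
  · simp [*]

theorem edgeCount_le_four (h : IsTileGraph P g) {A B C : Finset α} (hA : A ∈ P) (hB : B ∈ P)
    (hC : C ∈ P) (hAB : A ≠ B) (hAC : A ≠ C) (hBC : B ≠ C) (h₁ : Dominates g A C)
    (h₂ : Dominates g B C) : edgeCount g A B ≤ 4 := by
  classical
  obtain ⟨a₁, ha₁, a₂, ha₂, hne, hall, hsome⟩ := h₁
  obtain ⟨b₁, hb₁, b₂, hb₂, hne', hall', hsome'⟩ := h₂
  have d₁ := h.disj A hA B hB hAB
  have d₂ := h.disj A hA C hC hAC
  have d₃ := h.disj B hB C hC hBC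
  have hsub : ((A ×ˢ B).filter fun p => g p.1 p.2) ⊆ ({a₁, a₂} : Finset α) ×ˢ {b₁, b₂} := by
    rintro ⟨p, q⟩ hpq
    simp only [Finset.mem_filter, Finset.mem_product] at hpq
    obtain ⟨⟨hp, hq⟩, e⟩ := hpq
    simp only [Finset.mem_product, Finset.mem_insert, Finset.mem_singleton]
    constructor
    · by_contra! hcon
      obtain ⟨b, hb, hbq, hbs⟩ : ∃ b ∈ B, b ≠ q ∧ ∀ x, ∃ y ∈ C, y ≠ x ∧ g b y := by
        by_cases hb : b₁ = q
        · refine ⟨b₂, hb₂, by grind, fun x => ?_⟩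
          obtain ⟨y, hy, hyx, -⟩ := exists_mem_ne_of_card (h.card_eq C hC) x x x
          exact ⟨y, hy, hyx, hall' y hy⟩
        · refine ⟨b₁, hb₁, hb, fun x => ?_⟩
          obtain ⟨y, hy, hyx, -, ey⟩ := hsome' x x
          exact ⟨y, hy, hyx, ey⟩
      obtain ⟨x, hx, -, -, ex⟩ := hsome a₁ a₁
      obtain ⟨y, hy, hyx, ey⟩ := hbs x
      obtain ⟨z, hz, hz₁, hz₂, -⟩ := exists_mem_ne_of_card (h.card_eq C hC) x y y
      refine h.no_four hA hB hC e ex ey (hall z hz) ?_ ?_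
      · simp only [List.nodup_cons, List.mem_cons, List.not_mem_nil, List.nodup_nil]
        grind (splits := 40)
      · simp [*]
    · by_contra! hcon
      obtain ⟨b, hb, hbq, hbs⟩ : ∃ a ∈ A, a ≠ p ∧ ∀ x, ∃ y ∈ C, y ≠ x ∧ g a y := by
        by_cases hb : a₁ = p
        · refine ⟨a₂, ha₂, by grind, fun x => ?_⟩
          obtain ⟨y, hy, hyx, -⟩ := exists_mem_ne_of_card (h.card_eq C hC) x x x
          exact ⟨y, hy, hyx, hall y hy⟩
        · refine ⟨a₁, ha₁, hb, fun x => ?_⟩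
          obtain ⟨y, hy, hyx, -, ey⟩ := hsome x x
          exact ⟨y, hy, hyx, ey⟩
      obtain ⟨x, hx, -, -, ex⟩ := hsome' a₁ a₁
      obtain ⟨y, hy, hyx, ey⟩ := hbs x
      obtain ⟨z, hz, hz₁, hz₂, -⟩ := exists_mem_ne_of_card (h.card_eq C hC) x y y
      refine h.no_four hA hB hC e ex ey (hall' z hz) ?_ ?_
      · simp only [List.nodup_cons, List.mem_cons, List.not_mem_nil, List.nodup_nil]
        grind (splits := 40)
      · simp [*]
  refine (Finset.card_le_card hsub).trans ?_
  rw [Finset.card_product]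
  exact Nat.mul_le_mul Finset.card_le_two Finset.card_le_two

theorem star_center_unique (h : IsTileGraph P g) {A B C : Finset α} {c d : α} (hA : A ∈ P)
    (hB : B ∈ P) (hC : C ∈ P) (hAB : A ≠ B) (hAC : A ≠ C) (h₁ : StarAt g A B c)
    (h₂ : StarAt g A C d) : c = d := by
  by_contra hcd
  obtain ⟨hc, c', hc', hcB, hcA⟩ := h₁
  obtain ⟨hd, d', hd', hdC, hdA⟩ := h₂
  have d₁ := h.disj A hA B hB hAB
  have d₂ := h.disj A hA C hC hAC
  obtain ⟨p, hp, hp₁, hp₂, -⟩ := exists_mem_ne_of_card (h.card_eq A hA) c d d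
  obtain ⟨x, hx, hx₁, -, -⟩ := exists_mem_ne_of_card (h.card_eq B hB) c' c' c'
  by_cases hBC : B = C
  · subst hBC
    obtain ⟨y, hy, hy₁, hy₂, -⟩ := exists_mem_ne_of_card (h.card_eq B hB) c' x x
    refine h.no_three hA hB (hcB x hx) (hdC y hy) (hcA p hp) ?_ ?_
    · simp only [List.nodup_cons, List.mem_cons, List.not_mem_nil, List.nodup_nil]
      grind (splits := 40)
    · simp [*]
  · have d₃ := h.disj B hB C hC hBC
    obtain ⟨y, hy, hy₁, -, -⟩ := exists_mem_ne_of_card (h.card_eq C hC) d' d' d'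
    obtain ⟨q, hq, hq₁, hq₂, hq₃⟩ := exists_mem_ne_of_card (h.card_eq A hA) c d p
    refine h.no_four hA hB hC (hcB x hx) (hdC y hy) (hcA p hp) (hdA q hq) ?_ ?_
    · simp only [List.nodup_cons, List.mem_cons, List.not_mem_nil, List.nodup_nil]
      grind (splits := 40)
    · simp [*]

open Classical in
theorem sum_offDiag_boole_swap {β : Type*} [DecidableEq β] (s : Finset β) (r : β → β → Prop) :
    ∑ p ∈ s.offDiag, (if r p.2 p.1 then (1 : ℤ) else 0) =
      ∑ p ∈ s.offDiag, (if r p.1 p.2 then (1 : ℤ) else 0) := by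
  refine Finset.sum_bij (fun p _ => (p.2, p.1)) ?_ ?_ ?_ ?_
  · intro p hp
    simp only [Finset.mem_offDiag] at hp ⊢
    exact ⟨hp.2.1, hp.1, hp.2.2.symm⟩
  · rintro ⟨a, b⟩ _ ⟨c, d⟩ _ h
    simp only [Prod.mk.injEq] at h ⊢
    exact h.symm
  · rintro ⟨a, b⟩ h
    refine ⟨(b, a), ?_, rfl⟩
    simp only [Finset.mem_offDiag] at h ⊢
    exact ⟨h.2.1, h.1, h.2.2.symm⟩
  · intro p _
    rfl

open Classical in
theorem sum_offDiag_boole_mem {β : Type*} [DecidableEq β] {s t : Finset β} (hts : t ⊆ s) :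
    ∑ p ∈ s.offDiag, (if p.1 ∈ t ∧ p.2 ∈ t then (1 : ℤ) else 0) =
      (t.card : ℤ) * t.card - t.card := by
  have : s.offDiag.filter (fun p => p.1 ∈ t ∧ p.2 ∈ t) = t.offDiag := by
    ext p
    simp only [Finset.mem_filter, Finset.mem_offDiag]
    constructor
    · tauto
    · rintro ⟨h1, h2, h3⟩
      exact ⟨⟨hts h1, hts h2, h3⟩, h1, h2⟩
  rw [Finset.sum_boole, this, Finset.offDiag_card, Nat.cast_sub (Nat.le_mul_self _)]
  push_cast
  ring

open Classical in
theorem low_count_le (h : IsTileGraph P g) :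
    ∑ p ∈ P.offDiag, (if Dominates g p.1 p.2 ∨ Dominates g p.2 p.1 ∨ ∃ c, StarAt g p.1 p.2 c
      then (0 : ℤ) else 1) ≤ ∑ p ∈ P.offDiag, (7 - (edgeCount g p.1 p.2 : ℤ)) +
      2 * ∑ p ∈ P.offDiag, (if Dominates g p.1 p.2 then (1 : ℤ) else 0) := by
  have hs := sum_offDiag_boole_swap P (Dominates g)
  rw [two_mul]
  nth_rewrite 2 [← hs]
  rw [← Finset.sum_add_distrib, ← Finset.sum_add_distrib]
  refine Finset.sum_le_sum fun p hp => ?_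
  obtain ⟨hA, hB, hAB⟩ := Finset.mem_offDiag.mp hp
  obtain ⟨h8, h7⟩ := h.edgeCount_le hA hB hAB
  by_cases c7 : 7 ≤ edgeCount g p.1 p.2
  · rcases h7 c7 with h' | h' | h'
    · simp only [h', true_or, if_true]
      split_ifs <;> omega
    · simp only [h', true_or, or_true, if_true]
      split_ifs <;> omega
    · simp only [h'.1, or_true, if_true]
      split_ifs <;> omega
  · split_ifs <;> omega

open Classical in
theorem dominating_count_le (h : IsTileGraph P g) :
    ∑ p ∈ P.offDiag, (if Dominates g p.1 p.2 then (1 : ℤ) else 0) ≤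
      ∑ p ∈ P.offDiag, (7 - (edgeCount g p.1 p.2 : ℤ)) + 4 * P.card := by
  set k := ∑ p ∈ P.offDiag, (if Dominates g p.1 p.2 then (1 : ℤ) else 0) with hk
  set N : Finset α → Finset (Finset α) :=
    fun B => P.filter fun A => A ≠ B ∧ Dominates g A B with hN
  set T := P.filter fun B => (N B).Nonempty with hT
  obtain ⟨D, hDP, hDmax⟩ : ∃ D ⊆ P, (∀ B ∈ P, (N B).card ≤ D.card) ∧
      ∀ A ∈ D, ∀ B ∈ D, A ≠ B → edgeCount g A B ≤ 4 ∧ ¬ Dominates g A B ∧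
        ∀ X ∈ P, X ≠ A → ¬ Dominates g X A := by
    rcases P.eq_empty_or_nonempty with rfl | hne
    · exact ⟨∅, by simp, by simp, by simp⟩
    obtain ⟨Z, hZ, hmax⟩ := P.exists_max_image (fun B => (N B).card) hne
    refine ⟨N Z, Finset.filter_subset _ _, hmax, fun A hA B hB hAB => ?_⟩
    simp only [hN, Finset.mem_filter] at hA hB
    refine ⟨h.edgeCount_le_four hA.1 hB.1 hZ hAB hA.2.1 hB.2.1 hA.2.2 hB.2.2, fun hd => ?_,
      fun X hX hXA hd => ?_⟩
    · exact h.not_dominates_trans hA.1 hB.1 hZ hAB hB.2.1 hd hB.2.2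
    · exact h.not_dominates_trans hX hA.1 hZ hXA hA.2.1 hd hA.2.2
  obtain ⟨hmax, hD⟩ := hDmax
  have hkle : k ≤ T.card * D.card := by
    have : k = ∑ B ∈ P, ((N B).card : ℤ) := by
      rw [hk, Finset.sum_boole, ← Nat.cast_sum, Nat.cast_inj,
        Finset.card_eq_sum_card_fiberwise (f := Prod.snd) (t := P)
          (fun p hp => (Finset.mem_offDiag.mp (Finset.mem_filter.mp hp).1).2.1)]
      refine Finset.sum_congr rfl fun B hB => ?_
      refine Finset.card_bij (fun p _ => p.1) ?_ ?_ ?_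
      · rintro ⟨a, b⟩ hp
        simp only [Finset.mem_filter, Finset.mem_offDiag] at hp
        obtain ⟨⟨⟨h1, h2, h3⟩, h4⟩, rfl⟩ := hp
        simp [hN, h1, h3, h4]
      · rintro ⟨a, b⟩ hp ⟨c, d⟩ hq hac
        simp only [Finset.mem_filter] at hp hq
        ext1
        · exact hac
        · exact hp.2.trans hq.2.symm
      · intro A hA
        simp only [hN, Finset.mem_filter] at hA
        exact ⟨(A, B), by simp [hA, hB], rfl⟩
    rw [this, ← Finset.sum_filter_add_sum_filter_not P fun B => (N B).Nonempty]
    have hzero : ∑ B ∈ P with ¬ (N B).Nonempty, ((N B).card : ℤ) = 0 := by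
      refine Finset.sum_eq_zero fun B hB => ?_
      have := (Finset.mem_filter.mp hB).2
      rw [Finset.not_nonempty_iff_eq_empty] at this
      simp [this]
    rw [hzero, add_zero]
    refine (Finset.sum_le_card_nsmul _ _ (D.card : ℤ) fun B hB => ?_).trans ?_
    · exact_mod_cast hmax B (Finset.mem_filter.mp hB).1
    · simp [hT]
  have hmain : -(2 * k) + 3 * ((D.card : ℤ) * D.card - D.card) +
      ((T.card : ℤ) * T.card - T.card) ≤ ∑ p ∈ P.offDiag, (7 - (edgeCount g p.1 p.2 : ℤ)) := by
    have hs := sum_offDiag_boole_swap P (Dominates g)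
    rw [two_mul, ← sum_offDiag_boole_mem hDP, ← sum_offDiag_boole_mem (Finset.filter_subset _ P)]
    nth_rewrite 2 [hk]
    rw [← hs, hk, ← Finset.sum_add_distrib, ← Finset.sum_neg_distrib, Finset.mul_sum,
      ← Finset.sum_add_distrib, ← Finset.sum_add_distrib]
    refine Finset.sum_le_sum ?_
    rintro ⟨A, B⟩ hp
    obtain ⟨hA, hB, hAB⟩ := Finset.mem_offDiag.mp hp
    dsimp only at hA hB hAB ⊢
    obtain ⟨h8, h7⟩ := h.edgeCount_le hA hB hAB
    have hTnot : ∀ A ∈ T, ∃ X ∈ P, X ≠ A ∧ Dominates g X A := by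
      intro A hA
      obtain ⟨X, hX⟩ := (Finset.mem_filter.mp hA).2
      simp only [hN, Finset.mem_filter] at hX
      exact ⟨X, hX⟩
    by_cases hDD : A ∈ D ∧ B ∈ D
    · obtain ⟨h4, h5, h6⟩ := hD A hDD.1 B hDD.2 hAB
      have hAT : ¬ (A ∈ T ∧ B ∈ T) := fun hAT => by
        obtain ⟨X, hX, hXA, hd⟩ := hTnot A hAT.1
        exact h6 X hX hXA hd
      rw [if_pos hDD, if_neg hAT]
      split_ifs <;> omega
    rw [if_neg hDD]
    by_cases hTT : A ∈ T ∧ B ∈ T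
    · obtain ⟨X, hX, hXA, hdX⟩ := hTnot A hTT.1
      obtain ⟨Y, hY, hYB, hdY⟩ := hTnot B hTT.2
      have n1 : ¬ Dominates g A B := h.not_dominates_trans hX hA hB hXA hAB hdX
      have n2 : ¬ Dominates g B A := h.not_dominates_trans hY hB hA hYB hAB.symm hdY
      have n3 : ∀ c, ¬ StarAt g A B c := fun c hc =>
        h.not_star_of_dominates hX hA hB hXA (fun e => n2 (e ▸ hdX)) hAB hdX hc
      have : edgeCount g A B ≤ 6 := by
        by_contra! hcon
        rcases h7 hcon with h' | h' | ⟨⟨c, h'⟩, -⟩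
        exacts [n1 h', n2 h', n3 c h']
      rw [if_pos hTT, if_neg n1, if_neg n2]
      omega
    rw [if_neg hTT]
    by_cases c8 : 8 ≤ edgeCount g A B
    · rcases h7 (by omega) with h' | h' | h'
      · rw [if_pos h']
        split_ifs <;> omega
      · rw [if_pos h']
        split_ifs <;> omega
      · omega
    · split_ifs <;> omega
  have hT' : (T.card : ℤ) ≤ P.card := by
    exact_mod_cast Finset.card_le_card (Finset.filter_subset _ _)
  have hD' : (D.card : ℤ) ≤ P.card := by exact_mod_cast Finset.card_le_card hDP
  nlinarith [sq_nonneg (2 * (D.card : ℤ) - T.card), sq_nonneg (D.card : ℤ)]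

open Classical in
/-- All but few pairs of tiles are stars, up to the deficit from seven edges per pair. -/
theorem nonstar_count_le (h : IsTileGraph P g) :
    ((P.offDiag.filter fun p => ¬ ∃ c, StarAt g p.1 p.2 c).card : ℤ) ≤
      5 * ∑ p ∈ P.offDiag, (7 - (edgeCount g p.1 p.2 : ℤ)) + 16 * P.card := by
  have h1 := h.low_count_le
  have h2 := h.dominating_count_le
  have hs := sum_offDiag_boole_swap P (Dominates g)
  have h3 : ((P.offDiag.filter fun p => ¬ ∃ c, StarAt g p.1 p.2 c).card : ℤ) ≤
      ∑ p ∈ P.offDiag, (if Dominates g p.1 p.2 ∨ Dominates g p.2 p.1 ∨ ∃ c, StarAt g p.1 p.2 c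
        then (0 : ℤ) else 1) +
      (∑ p ∈ P.offDiag, (if Dominates g p.1 p.2 then (1 : ℤ) else 0) +
      ∑ p ∈ P.offDiag, (if Dominates g p.2 p.1 then (1 : ℤ) else 0)) := by
    rw [← Finset.sum_boole, ← Finset.sum_add_distrib, ← Finset.sum_add_distrib]
    refine Finset.sum_le_sum fun p _ => ?_
    by_cases a : Dominates g p.1 p.2 <;> by_cases b : Dominates g p.2 p.1 <;>
      by_cases c : ∃ c, StarAt g p.1 p.2 c <;> simp [a, b, c]
  linarith

end IsTileGraph

/-- The vertex set of a copy of `𝒴`. -/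
def IsYSet {α : Type*} [DecidableEq α] (H : Finset (Finset α)) (t : Finset α) : Prop :=
  ∃ a b c d, YCopy H a b c d ∧ t = {a, b, c, d}

/-- A family of pairwise disjoint vertex sets of copies of `𝒴`. -/
structure IsYFamily {α : Type*} [DecidableEq α] (H P : Finset (Finset α)) : Prop where
  isYSet : ∀ t ∈ P, IsYSet H t
  disj : ∀ s ∈ P, ∀ t ∈ P, s ≠ t → ∀ x ∈ s, x ∉ t

/-- A `𝒴`-family with the largest possible number of members. -/
structure IsMaxYFamily {α : Type*} [DecidableEq α] (H P : Finset (Finset α)) : Prop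
    extends IsYFamily H P where
  card_le : ∀ Q, IsYFamily H Q → Q.card ≤ P.card

/-- The vertices outside all members of `P`. -/
def uncovered {α : Type*} [DecidableEq α] [Fintype α] (P : Finset (Finset α)) : Finset α :=
  Finset.univ.filter fun u => ∀ A ∈ P, u ∉ A

/-- The pair `x, y` lies in at least sixteen edges with an uncovered third vertex. -/
def Heavy {α : Type*} [DecidableEq α] [Fintype α] (H P : Finset (Finset α)) (x y : α) : Prop :=
  16 ≤ ((uncovered P).filter fun u => {x, y, u} ∈ H).card

/-- There is a `𝒴`-family with `k` members using only covered vertices in `W` and at most `2 * k`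
uncovered vertices. -/
def Packs {α : Type*} [DecidableEq α] [Fintype α] (H P : Finset (Finset α)) (k : ℕ)
    (W : Finset α) : Prop :=
  ∃ Q, IsYFamily H Q ∧ Q.card = k ∧ (∀ t ∈ Q, ∀ x ∈ t, x ∈ W ∨ x ∈ uncovered P) ∧
    ((uncovered P).filter fun x => ∃ t ∈ Q, x ∈ t).card ≤ 2 * k

section YFamily

variable {α : Type*} [DecidableEq α] {H P : Finset (Finset α)}

theorem ne_of_triple_mem (hH : ∀ e ∈ H, e.card = 3) {x y z : α} (h : {x, y, z} ∈ H) :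
    x ≠ y ∧ x ≠ z ∧ y ≠ z := by
  have h3 := hH _ h
  refine ⟨?_, ?_, ?_⟩ <;> rintro rfl
  · have := Finset.card_le_two (a := x) (b := z)
    simp at h3
    omega
  · have := Finset.card_le_two (a := x) (b := y)
    rw [Finset.pair_comm y x, Finset.insert_idem] at h3
    omega
  · have := Finset.card_le_two (a := x) (b := y)
    simp at h3
    omega

theorem isYSet_of_pair (hH : ∀ e ∈ H, e.card = 3) {x y u v : α} (huv : u ≠ v)
    (hu : {x, y, u} ∈ H) (hv : {x, y, v} ∈ H) : IsYSet H {x, y, u, v} := by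
  obtain ⟨h1, h2, h3⟩ := ne_of_triple_mem hH hu
  obtain ⟨-, h4, h5⟩ := ne_of_triple_mem hH hv
  have e1 : ({u, x, y} : Finset α) = {x, y, u} := by
    ext; simp only [Finset.mem_insert, Finset.mem_singleton]; tauto
  have e2 : ({x, y, u, v} : Finset α) = {u, x, y, v} := by
    ext; simp only [Finset.mem_insert, Finset.mem_singleton]; tauto
  refine ⟨u, x, y, v, ⟨?_, e1 ▸ hu, hv⟩, e2⟩
  rw [Finset.card_insert_of_notMem, Finset.card_insert_of_notMem, Finset.card_pair h5]
  · simp [h1, h4]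
  · simp [h2.symm, h3.symm, huv]

theorem IsYSet.card_eq {t : Finset α} (h : IsYSet H t) : t.card = 4 := by
  obtain ⟨a, b, c, d, h, rfl⟩ := h
  exact h.1

theorem isYFamily_empty : IsYFamily H ∅ := ⟨by simp, by simp⟩

theorem IsYFamily.insert {Q : Finset (Finset α)} (hQ : IsYFamily H Q) {t : Finset α}
    (ht : IsYSet H t) (hd : ∀ s ∈ Q, ∀ x ∈ s, x ∉ t) : IsYFamily H (insert t Q) ∧ t ∉ Q := by
  refine ⟨⟨?_, ?_⟩, fun h => ?_⟩
  · intro s hs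
    rcases Finset.mem_insert.mp hs with rfl | hs
    exacts [ht, hQ.isYSet s hs]
  · intro s hs r hr hsr x hxs hxr
    rcases Finset.mem_insert.mp hs with hs' | hs' <;>
      rcases Finset.mem_insert.mp hr with hr' | hr'
    · exact hsr (hs'.trans hr'.symm)
    · exact hd r hr' x hxr (hs' ▸ hxs)
    · exact hd s hs' x hxs (hr' ▸ hxr)
    · exact hQ.disj s hs' r hr' hsr x hxs hxr
  · obtain ⟨x, hx⟩ : t.Nonempty := Finset.card_pos.mp (by rw [ht.card_eq]; omega)
    exact hd t h x hx hx

theorem IsMaxYFamily.exchange [Fintype α] (hP : IsMaxYFamily H P) {Q J : Finset (Finset α)}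
    (hQ : IsYFamily H Q) (hJ : J ⊆ P)
    (hQJ : ∀ t ∈ Q, ∀ x ∈ t, (∃ A ∈ J, x ∈ A) ∨ x ∈ uncovered P) : Q.card ≤ J.card := by
  have hcross : ∀ s ∈ P \ J, ∀ t ∈ Q, ∀ x ∈ s, x ∉ t := by
    intro s hs t ht x hxs hxt
    obtain ⟨hsP, hsJ⟩ := Finset.mem_sdiff.mp hs
    rcases hQJ t ht x hxt with ⟨A, hA, hxA⟩ | hx
    · exact hP.disj s hsP A (hJ hA) (fun e => hsJ (e ▸ hA)) x hxs hxA
    · exact (Finset.mem_filter.mp hx).2 s hsP hxs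
  have hfam : IsYFamily H (P \ J ∪ Q) := by
    refine ⟨fun t ht => ?_, fun s hs t ht hst x hxs hxt => ?_⟩
    · rcases Finset.mem_union.mp ht with ht | ht
      exacts [hP.isYSet t (Finset.mem_sdiff.mp ht).1, hQ.isYSet t ht]
    · rcases Finset.mem_union.mp hs with hs | hs <;> rcases Finset.mem_union.mp ht with ht | ht
      · exact hP.disj s (Finset.mem_sdiff.mp hs).1 t (Finset.mem_sdiff.mp ht).1 hst x hxs hxt
      · exact hcross s hs t ht x hxs hxt
      · exact hcross t ht s hs x hxt hxs
      · exact hQ.disj s hs t ht hst x hxs hxt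
  have hdisj : Disjoint (P \ J) Q := by
    rw [Finset.disjoint_left]
    intro s hs hsQ
    obtain ⟨x, hx⟩ : s.Nonempty :=
      Finset.card_pos.mp (by rw [(hQ.isYSet s hsQ).card_eq]; omega)
    exact hcross s hs s hsQ x hx hx
  have h1 := hP.card_le _ hfam
  rw [Finset.card_union_of_disjoint hdisj, Finset.card_sdiff_of_subset hJ] at h1
  have h2 := Finset.card_le_card hJ
  omega

variable [Fintype α]

theorem packs_zero : Packs H P 0 ∅ := ⟨∅, isYFamily_empty, by simp, by simp, by simp⟩

theorem packs_one {t : Finset α} (ht : IsYSet H t) (hc : ∀ x ∈ t, ∃ A ∈ P, x ∈ A) :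
    Packs H P 1 t := by
  refine ⟨{t}, ⟨by simpa, by simp +contextual⟩, by simp, by simp +contextual, ?_⟩
  have : (uncovered P).filter (fun x => ∃ s ∈ ({t} : Finset (Finset α)), x ∈ s) = ∅ := by
    rw [Finset.filter_eq_empty_iff]
    rintro x hx ⟨s, hs, hxs⟩
    obtain ⟨A, hA, hxA⟩ := hc x (Finset.mem_singleton.mp hs ▸ hxs)
    exact (Finset.mem_filter.mp hx).2 A hA hxA
  rw [this]
  simp

theorem Packs.cons (hH : ∀ e ∈ H, e.card = 3) {k : ℕ} {W : Finset α} (h : Packs H P k W)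
    (hk : k ≤ 7) {x y : α} (hx : x ∉ W) (hy : y ∉ W) (hxP : ∃ A ∈ P, x ∈ A)
    (hyP : ∃ A ∈ P, y ∈ A) (hg : Heavy H P x y) : Packs H P (k + 1) (insert x (insert y W)) := by
  obtain ⟨Q, hQ, hcard, hsub, hun⟩ := h
  set Z := (uncovered P).filter fun x => ∃ t ∈ Q, x ∈ t with hZ
  have hlt : 1 < (((uncovered P).filter fun u => {x, y, u} ∈ H) \ Z).card := by
    have := Finset.le_card_sdiff Z ((uncovered P).filter fun u => {x, y, u} ∈ H)
    unfold Heavy at hg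
    omega
  obtain ⟨u, hu, v, hv, huv⟩ := Finset.one_lt_card.mp hlt
  simp only [Finset.mem_sdiff, Finset.mem_filter, hZ, not_and] at hu hv
  obtain ⟨⟨huP, huH⟩, huQ⟩ := hu
  obtain ⟨⟨hvP, hvH⟩, hvQ⟩ := hv
  have ncov : ∀ z, (∃ A ∈ P, z ∈ A) → z ∉ uncovered P := by
    rintro z ⟨A, hA, hzA⟩ hz
    exact (Finset.mem_filter.mp hz).2 A hA hzA
  obtain ⟨hfam, hnot⟩ := hQ.insert (isYSet_of_pair hH huv huH hvH) (by
    intro s hs z hz hzt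
    simp only [Finset.mem_insert, Finset.mem_singleton] at hzt
    rcases hzt with rfl | rfl | rfl | rfl
    · exact (hsub s hs z hz).elim hx (ncov z hxP)
    · exact (hsub s hs z hz).elim hy (ncov z hyP)
    · exact huQ huP ⟨s, hs, hz⟩
    · exact hvQ hvP ⟨s, hs, hz⟩)
  refine ⟨_, hfam, by rw [Finset.card_insert_of_notMem hnot, hcard], ?_, ?_⟩
  · intro t ht z hz
    rcases Finset.mem_insert.mp ht with rfl | ht
    · simp only [Finset.mem_insert, Finset.mem_singleton] at hz ⊢
      rcases hz with rfl | rfl | rfl | rfl <;> tauto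
    · simp only [Finset.mem_insert]
      have := hsub t ht z hz
      tauto
  · refine (Finset.card_le_card (t := insert u (insert v Z)) ?_).trans ?_
    · intro z hz
      simp only [Finset.mem_filter, Finset.mem_insert, exists_eq_or_imp,
        Finset.mem_singleton] at hz
      simp only [Finset.mem_insert, hZ, Finset.mem_filter]
      obtain ⟨hz, (rfl | rfl | rfl | rfl) | h⟩ := hz
      · exact (ncov _ hxP hz).elim
      · exact (ncov _ hyP hz).elim
      · tauto
      · tauto
      · tauto
    · refine (Finset.card_insert_le _ _).trans ?_
      have := Finset.card_insert_le v Z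
      omega

theorem Packs.append (hH : ∀ e ∈ H, e.card = 3) (l : List (α × α)) :
    ∀ {k : ℕ} {W : Finset α}, Packs H P k W → k + l.length ≤ 8 →
    (∀ p ∈ l, Heavy H P p.1 p.2) → (l.flatMap fun p => [p.1, p.2]).Nodup →
    (∀ x ∈ l.flatMap fun p => [p.1, p.2], x ∉ W ∧ ∃ A ∈ P, x ∈ A) →
    Packs H P (k + l.length) (W ∪ (l.flatMap fun p => [p.1, p.2]).toFinset) := by
  induction l with
  | nil => intro k W h; simp [h]
  | cons p l ih =>
    intro k W h hk hg hn hm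
    obtain ⟨x, y⟩ := p
    simp only [List.flatMap_cons, List.cons_append, List.nil_append, List.nodup_cons,
      List.mem_cons, not_or, List.length_cons, forall_eq_or_imp] at hg hn hm hk ⊢
    have h' := h.cons hH (by omega) hm.1.1 hm.2.1.1 hm.1.2 hm.2.1.2 hg.1
    have := ih h' (by omega) hg.2 hn.2.2 (by
      intro z hz
      refine ⟨?_, (hm.2.2 z hz).2⟩
      have := (hm.2.2 z hz).1
      simp only [Finset.mem_insert, not_or]
      exact ⟨fun e => hn.1.2 (e ▸ hz), fun e => hn.2.1 (e ▸ hz), this⟩)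
    convert this using 1
    · omega
    · ext z
      simp only [Finset.mem_union, Finset.mem_insert, List.mem_toFinset, List.mem_cons]
      tauto

theorem IsMaxYFamily.packs_le (hP : IsMaxYFamily H P) {k : ℕ} {W : Finset α} (h : Packs H P k W)
    {J : Finset (Finset α)} (hJ : J ⊆ P) (hW : ∀ x ∈ W, ∃ A ∈ J, x ∈ A) : k ≤ J.card := by
  obtain ⟨Q, hQ, hcard, hsub, -⟩ := h
  rw [← hcard]
  exact hP.exchange hQ hJ fun t ht x hx => (hsub t ht x hx).imp (hW x) id

theorem IsMaxYFamily.isTileGraph (hH : ∀ e ∈ H, e.card = 3) (hP : IsMaxYFamily H P) :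
    IsTileGraph P (Heavy H P) where
  symm x y h := by
    unfold Heavy at h ⊢
    simpa only [Finset.insert_comm y x] using h
  card_eq A hA := (hP.isYSet A hA).card_eq
  disj := hP.disj
  length_le l hl hg hn J hJ hm := by
    have := Packs.append hH l packs_zero (by omega) hg hn
      (fun x hx => ⟨by simp, (hm x hx).imp fun A hA => ⟨hJ hA.1, hA.2⟩⟩)
    simpa using hP.packs_le this hJ (by simpa using hm)

/-- Four tiles whose star centers dominate two further tiles forming a star pair contain no copy
of `𝒴` avoiding the centers. -/
theorem IsMaxYFamily.not_isYSet_of_stars (hH : ∀ e ∈ H, e.card = 3) (hP : IsMaxYFamily H P)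
    {A : Fin 4 → Finset α} {c : Fin 4 → α} {B C : Finset α} {b : α} (hA : ∀ i, A i ∈ P)
    (hB : B ∈ P) (hC : C ∈ P) (hinj : Function.Injective A) (hAB : ∀ i, A i ≠ B)
    (hAC : ∀ i, A i ≠ C) (hBC : B ≠ C) (hsB : ∀ i, StarAt (Heavy H P) (A i) B (c i))
    (hsC : ∀ i, StarAt (Heavy H P) (A i) C (c i)) (hs : StarAt (Heavy H P) B C b)
    {t : Finset α} (ht : IsYSet H t) (htA : ∀ x ∈ t, ∃ i, x ∈ A i ∧ x ≠ c i) : False := by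
  obtain ⟨hb, b', hb', hbC, hbB⟩ := hs
  have hB4 := (hP.isYSet B hB).card_eq
  have hC4 := (hP.isYSet C hC).card_eq
  obtain ⟨x₁, hx₁, hx₁b, -, -⟩ := exists_mem_ne_of_card hB4 b b b
  obtain ⟨x₂, hx₂, hx₂b, hx₂₁, -⟩ := exists_mem_ne_of_card hB4 b x₁ x₁
  obtain ⟨x₃, hx₃, hx₃b, hx₃₁, hx₃₂⟩ := exists_mem_ne_of_card hB4 b x₁ x₂
  obtain ⟨y₁, hy₁, hy₁b, -, -⟩ := exists_mem_ne_of_card hC4 b' b' b'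
  obtain ⟨y₂, hy₂, hy₂b, hy₂₁, -⟩ := exists_mem_ne_of_card hC4 b' y₁ y₁
  obtain ⟨y₃, hy₃, hy₃b, hy₃₁, hy₃₂⟩ := exists_mem_ne_of_card hC4 b' y₁ y₂
  have hgB : ∀ i, ∀ x ∈ B, Heavy H P (c i) x := fun i => by
    obtain ⟨-, d, hd, h, -⟩ := hsB i
    exact h
  have hgC : ∀ i, ∀ x ∈ C, Heavy H P (c i) x := fun i => by
    obtain ⟨-, d, hd, h, -⟩ := hsC i
    exact h
  have hcA : ∀ i, c i ∈ A i := fun i => (hsB i).1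
  have dAA : ∀ i j, i ≠ j → ∀ x ∈ A i, x ∉ A j := fun i j hij =>
    hP.disj _ (hA i) _ (hA j) (hinj.ne hij)
  have dAB : ∀ i, ∀ x ∈ A i, x ∉ B := fun i => hP.disj _ (hA i) _ hB (hAB i)
  have dAC : ∀ i, ∀ x ∈ A i, x ∉ C := fun i => hP.disj _ (hA i) _ hC (hAC i)
  have dBC := hP.disj _ hB _ hC hBC
  have cB : ∀ i, c i ∉ B := fun i => dAB i _ (hcA i)
  have cC : ∀ i, c i ∉ C := fun i => dAC i _ (hcA i)
  have cc : ∀ i j, i ≠ j → c i ≠ c j := fun i j hij e =>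
    dAA i j hij _ (hcA i) (e ▸ hcA j)
  have tB : ∀ x ∈ t, x ∉ B := fun x hx => by
    obtain ⟨i, hi, -⟩ := htA x hx
    exact dAB i x hi
  have tC : ∀ x ∈ t, x ∉ C := fun x hx => by
    obtain ⟨i, hi, -⟩ := htA x hx
    exact dAC i x hi
  have tc : ∀ i, c i ∉ t := fun i hi => by
    obtain ⟨j, hj, hne⟩ := htA _ hi
    by_cases hij : i = j
    · exact hne (hij ▸ rfl)
    · exact dAA i j hij _ (hcA i) hj
  set J : Finset (Finset α) := insert B (insert C (Finset.univ.image A)) with hJ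
  have hJP : J ⊆ P := by
    intro X hX
    simp only [hJ, Finset.mem_insert, Finset.mem_image, Finset.mem_univ, true_and] at hX
    rcases hX with rfl | rfl | ⟨i, rfl⟩
    exacts [hB, hC, hA i]
  have hJ6 : J.card ≤ 6 := by
    have h1 := Finset.card_insert_le B (insert C (Finset.univ.image A))
    have h2 := Finset.card_insert_le C (Finset.univ.image A)
    have h3 := Finset.card_image_le (s := Finset.univ) (f := A)
    simp only [Finset.card_univ, Fintype.card_fin] at h3
    rw [hJ]
    omega
  have hAJ : ∀ i, A i ∈ J := fun i => by simp [hJ]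
  have hBJ : B ∈ J := by simp [hJ]
  have hCJ : C ∈ J := by simp [hJ]
  set l : List (α × α) := [(c 0, x₁), (c 1, x₂), (b', x₃), (c 2, y₁), (c 3, y₂), (b, y₃)] with hl
  have hlJ : ∀ x ∈ l.flatMap fun p => [p.1, p.2], x ∉ t ∧ ∃ X ∈ J, x ∈ X := by
    intro x hx
    simp only [hl, List.flatMap_cons, List.flatMap_nil, List.cons_append, List.nil_append,
      List.mem_cons, List.not_mem_nil, or_false] at hx
    rcases hx with rfl | rfl | rfl | rfl | rfl | rfl | rfl | rfl | rfl | rfl | rfl | rfl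
    · exact ⟨tc 0, A 0, hAJ 0, hcA 0⟩
    · exact ⟨fun h => tB _ h hx₁, B, hBJ, hx₁⟩
    · exact ⟨tc 1, A 1, hAJ 1, hcA 1⟩
    · exact ⟨fun h => tB _ h hx₂, B, hBJ, hx₂⟩
    · exact ⟨fun h => tC _ h hb', C, hCJ, hb'⟩
    · exact ⟨fun h => tB _ h hx₃, B, hBJ, hx₃⟩
    · exact ⟨tc 2, A 2, hAJ 2, hcA 2⟩
    · exact ⟨fun h => tC _ h hy₁, C, hCJ, hy₁⟩
    · exact ⟨tc 3, A 3, hAJ 3, hcA 3⟩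
    · exact ⟨fun h => tC _ h hy₂, C, hCJ, hy₂⟩
    · exact ⟨fun h => tB _ h hb, B, hBJ, hb⟩
    · exact ⟨fun h => tC _ h hy₃, C, hCJ, hy₃⟩
  have hsymm := (hP.isTileGraph hH).symm
  have htJ : ∀ x ∈ t, ∃ X ∈ J, x ∈ X := fun x hx => by
    obtain ⟨i, hi, -⟩ := htA x hx
    exact ⟨A i, hAJ i, hi⟩
  have hpack := Packs.append hH l
    (packs_one (P := P) ht fun x hx => (htJ x hx).imp fun X hX => ⟨hJP hX.1, hX.2⟩)
    (by simp [hl]) (by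
      simp only [hl, List.mem_cons, List.not_mem_nil, or_false, forall_eq_or_imp, forall_eq]
      exact ⟨hgB 0 _ hx₁, hgB 1 _ hx₂, hsymm _ _ (hbB _ hx₃), hgC 2 _ hy₁, hgC 3 _ hy₂,
        hbC _ hy₃⟩)
    (by
      have c01 := cc 0 1 (by decide)
      have c02 := cc 0 2 (by decide)
      have c03 := cc 0 3 (by decide)
      have c12 := cc 1 2 (by decide)
      have c13 := cc 1 3 (by decide)
      have c23 := cc 2 3 (by decide)
      have b0 := cB 0
      have b1 := cB 1
      have b2 := cB 2
      have b3 := cB 3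
      have d0 := cC 0
      have d1 := cC 1
      have d2 := cC 2
      have d3 := cC 3
      clear_value J
      clear hAJ hlJ htJ hcA dAA dAB dAC cB cC cc tB tC tc hgB hgC hsB hsC hAB hAC hinj hA htA
        hsymm
      simp only [hl, List.flatMap_cons, List.flatMap_nil, List.cons_append, List.nil_append,
        List.nodup_cons, List.mem_cons, List.not_mem_nil, List.nodup_nil]
      clear hl l
      grind (splits := 80))
    (fun x hx => ⟨(hlJ x hx).1, (hlJ x hx).2.imp fun X hX => ⟨hJP hX.1, hX.2⟩⟩)
  have := hP.packs_le hpack hJP (fun x hx => by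
    rcases Finset.mem_union.mp hx with hx | hx
    · exact htJ x hx
    · exact (hlJ x (List.mem_toFinset.mp hx)).2)
  simp only [hl, List.length_cons, List.length_nil] at this
  omega

end YFamily

/-- The number of triples in `X × Y × Z` spanning an edge of `H`. -/
def tripleCount {α : Type*} [DecidableEq α] (H : Finset (Finset α)) (X Y Z : Finset α) : ℕ :=
  ∑ x ∈ X, ∑ y ∈ Y, ∑ z ∈ Z, if {x, y, z} ∈ H then 1 else 0

section Counting

variable {α : Type*} [DecidableEq α] {H P : Finset (Finset α)}

theorem two_mul_hdeg_le [Fintype α] (hH : ∀ e ∈ H, e.card = 3) (u : α) :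
    2 * hdeg H u ≤ ∑ x, ∑ y, if {x, y, u} ∈ H then 1 else 0 := by
  rw [← Fintype.sum_prod_type' (f := fun x y : α => if {x, y, u} ∈ H then 1 else 0),
    ← Finset.card_filter]
  rw [Finset.card_eq_sum_card_fiberwise (f := fun p : α × α => ({p.1, p.2, u} : Finset α))
    (t := H.filter fun e => u ∈ e)]
  · unfold hdeg
    rw [mul_comm, ← smul_eq_mul]
    refine Finset.card_nsmul_le_sum _ _ _ fun e he => ?_
    obtain ⟨heH, hue⟩ := Finset.mem_filter.mp he
    obtain ⟨a, b, hab, he'⟩ := Finset.card_eq_two.mp (show (e.erase u).card = 2 by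
      rw [Finset.card_erase_of_mem hue, hH e heH])
    have hee : e = {a, b, u} := by
      rw [← Finset.insert_erase hue, he']
      ext z
      simp only [Finset.mem_insert, Finset.mem_singleton]
      tauto
    refine Finset.one_lt_card.mpr ⟨(a, b), ?_, (b, a), ?_, ?_⟩
    · simp [← hee, heH]
    · simp only [Finset.mem_filter, Finset.mem_univ, true_and]
      rw [Finset.insert_comm, ← hee]
      exact ⟨heH, rfl⟩
    · simp [hab]
  · intro p hp
    simpa using hp

theorem sum_eq_sum_uncovered_add [Fintype α] (hP : IsYFamily H P) (f : α → ℕ) :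
    ∑ x, f x = ∑ x ∈ uncovered P, f x + ∑ A ∈ P, ∑ x ∈ A, f x := by
  rw [← Finset.sum_biUnion (fun A hA B hB hAB => Finset.disjoint_left.mpr
    (hP.disj A hA B hB hAB)), ← Finset.sum_union]
  · congr 1
    ext x
    simp only [uncovered, Finset.mem_univ, Finset.mem_union, Finset.mem_filter, true_and,
      Finset.mem_biUnion, true_iff]
    by_cases h : ∃ A ∈ P, x ∈ A
    · exact Or.inr h
    · push Not at h
      exact Or.inl h
  · rw [Finset.disjoint_left]
    intro x hx hx'
    obtain ⟨A, hA, hxA⟩ := Finset.mem_biUnion.mp hx'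
    exact (Finset.mem_filter.mp hx).2 A hA hxA

theorem exists_cherry_of_lt {U Z : Finset α} (hZ : Z.card ≤ 3) {r : α → α → Prop}
    [DecidableRel r] (h : 7 * U.card < ∑ y ∈ U, ∑ z ∈ U, if r y z then 1 else 0) :
    ∃ y ∈ U \ Z, ∃ v ∈ U \ Z, ∃ w ∈ U \ Z, v ≠ w ∧ r y v ∧ r y w := by
  by_contra! hcon
  have hUZ : (U ∩ Z).card ≤ 3 := (Finset.card_le_card Finset.inter_subset_right).trans hZ
  have hrow : ∀ y ∈ U \ Z, (∑ z ∈ U, if r y z then 1 else 0) ≤ 4 := by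
    intro y hy
    rw [← Finset.sum_inter_add_sum_sdiff U Z, ← Finset.card_filter, ← Finset.card_filter]
    have h1 := Finset.card_filter_le (U ∩ Z) fun z => r y z
    have h2 : ((U \ Z).filter fun z => r y z).card ≤ 1 := by
      refine Finset.card_le_one.mpr fun v hv w hw => ?_
      by_contra hne
      exact hcon y hy v (Finset.mem_filter.mp hv).1 w (Finset.mem_filter.mp hw).1 hne
        (Finset.mem_filter.mp hv).2 (Finset.mem_filter.mp hw).2
    omega
  have hrow' : ∀ y ∈ U ∩ Z, (∑ z ∈ U, if r y z then 1 else 0) ≤ U.card := by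
    intro y _
    rw [← Finset.card_filter]
    exact Finset.card_filter_le _ _
  rw [← Finset.sum_inter_add_sum_sdiff U Z] at h
  have h1 := Finset.sum_le_card_nsmul _ _ _ hrow
  have h2 := Finset.sum_le_card_nsmul _ _ _ hrow'
  have h3 : (U \ Z).card ≤ U.card := Finset.card_le_card Finset.sdiff_subset
  simp only [smul_eq_mul] at h1 h2
  nlinarith

theorem sum_le_add_of_card_eq_four {A : Finset α} (hA : A.card = 4) {f : α → ℕ} {K M : ℕ}
    (hM : ∀ x ∈ A, f x ≤ M) (hK : ∀ x ∈ A, ∀ y ∈ A, K < f x → K < f y → x = y) :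
    ∑ x ∈ A, f x ≤ M + 4 * K := by
  by_cases h : ∃ x ∈ A, K < f x
  · obtain ⟨x, hx, hxK⟩ := h
    rw [← Finset.add_sum_erase _ _ hx]
    have := Finset.sum_le_card_nsmul (A.erase x) (fun z => f z) K fun y hy => by
      by_contra! hy'
      exact (Finset.mem_erase.mp hy).1 (hK y (Finset.mem_erase.mp hy).2 x hx hy' hxK)
    rw [Finset.card_erase_of_mem hx, hA, smul_eq_mul] at this
    have := hM x hx
    omega
  · push Not at h
    have := Finset.sum_le_card_nsmul A (fun z => f z) K h
    rw [hA, smul_eq_mul] at this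
    omega

variable [Fintype α]

theorem IsMaxYFamily.tripleCount_uncovered_le (hH : ∀ e ∈ H, e.card = 3)
    (hP : IsMaxYFamily H P) :
    tripleCount H (uncovered P) (uncovered P) (uncovered P) ≤ (uncovered P).card ^ 2 := by
  have h : ∀ x ∈ uncovered P, ∀ y ∈ uncovered P,
      (∑ z ∈ uncovered P, if {x, y, z} ∈ H then 1 else 0) ≤ 1 := by
    intro x hx y hy
    rw [← Finset.card_filter]
    refine Finset.card_le_one.mpr fun v hv w hw => ?_
    by_contra hne
    simp only [Finset.mem_filter] at hv hw
    have hfam := (isYFamily_empty (H := H)).insert (isYSet_of_pair hH hne hv.2 hw.2) (by simp)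
    have := hP.exchange hfam.1 (Finset.empty_subset P) (by
      intro t ht z hz
      simp only [insert_empty_eq, Finset.mem_singleton] at ht
      subst ht
      simp only [Finset.mem_insert, Finset.mem_singleton] at hz
      right
      rcases hz with rfl | rfl | rfl | rfl
      exacts [hx, hy, hv.1, hw.1])
    simp at this
  refine (Finset.sum_le_card_nsmul _ _ _ fun x hx =>
    Finset.sum_le_card_nsmul _ _ _ (h x hx)).trans ?_
  simp [sq]

theorem IsMaxYFamily.tripleCount_tile_le (hH : ∀ e ∈ H, e.card = 3) (hP : IsMaxYFamily H P)
    {A : Finset α} (hA : A ∈ P) : tripleCount H A (uncovered P) (uncovered P) ≤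
      (uncovered P).card ^ 2 + 28 * (uncovered P).card := by
  have key := sum_le_add_of_card_eq_four (hP.isYSet A hA).card_eq
    (f := fun x => ∑ y ∈ uncovered P, ∑ z ∈ uncovered P, if {x, y, z} ∈ H then 1 else 0)
    (K := 7 * (uncovered P).card) (M := (uncovered P).card ^ 2) ?_ ?_
  · unfold tripleCount
    omega
  · intro x _
    refine (Finset.sum_le_card_nsmul _ _ (uncovered P).card fun y _ => ?_).trans ?_
    · rw [← Finset.card_filter]
      exact Finset.card_filter_le _ _
    · simp [sq]
  · intro x hx x' hx' hd hd'
    by_contra hne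
    have hU : ∀ z ∈ A, z ∉ uncovered P := fun z hz hzU => (Finset.mem_filter.mp hzU).2 A hA hz
    obtain ⟨y, hy, v, hv, w, hw, hvw, e₁, e₂⟩ := exists_cherry_of_lt (Z := ∅) (by simp) hd
    obtain ⟨y', hy', v', hv', w', hw', hvw', e₁', e₂'⟩ :=
      exists_cherry_of_lt (Z := {y, v, w}) Finset.card_le_three hd'
    simp only [Finset.sdiff_empty] at hy hv hw
    simp only [Finset.mem_sdiff, Finset.mem_insert, Finset.mem_singleton, not_or] at hy' hv' hw'
    have hfam := (isYFamily_empty (H := H)).insert (isYSet_of_pair hH hvw e₁ e₂) (by simp)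
    have hfam' := hfam.1.insert (isYSet_of_pair hH hvw' e₁' e₂') (by
      intro s hs z hz hz'
      simp only [insert_empty_eq, Finset.mem_singleton] at hs
      subst hs
      simp only [Finset.mem_insert, Finset.mem_singleton] at hz hz'
      have := hU x hx
      have := hU x' hx'
      grind)
    have h1 := hP.exchange hfam'.1 (Finset.singleton_subset_iff.mpr hA) (by
      intro t ht z hz
      simp only [insert_empty_eq, Finset.mem_singleton, Finset.mem_insert] at ht
      rcases ht with rfl | rfl <;> simp only [Finset.mem_insert, Finset.mem_singleton] at hz
      · rcases hz with h | h | h | h <;> rw [h]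
        exacts [Or.inl ⟨A, by simp, hx'⟩, Or.inr hy'.1, Or.inr hv'.1, Or.inr hw'.1]
      · rcases hz with h | h | h | h <;> rw [h]
        exacts [Or.inl ⟨A, by simp, hx⟩, Or.inr hy, Or.inr hv, Or.inr hw])
    rw [Finset.card_insert_of_notMem hfam'.2, Finset.card_insert_of_notMem hfam.2] at h1
    simp at h1

theorem tripleCount_le_edgeCount (A B : Finset α) (hA : A.card = 4) (hB : B.card = 4) :
    tripleCount H A B (uncovered P) ≤
      (uncovered P).card * edgeCount (Heavy H P) A B + 256 := by
  classical
  have h : ∀ x y, (∑ z ∈ uncovered P, if {x, y, z} ∈ H then 1 else 0) ≤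
      (uncovered P).card * (if Heavy H P x y then 1 else 0) + 16 := by
    intro x y
    rw [← Finset.card_filter]
    split_ifs with hg
    · have := Finset.card_filter_le (uncovered P) (fun z => {x, y, z} ∈ H)
      omega
    · unfold Heavy at hg
      omega
  have hE : edgeCount (Heavy H P) A B = ∑ x ∈ A, ∑ y ∈ B, if Heavy H P x y then 1 else 0 := by
    unfold edgeCount
    rw [Finset.card_filter, Finset.sum_product]
  refine (Finset.sum_le_sum fun x _ => Finset.sum_le_sum fun y _ => h x y).trans ?_
  rw [hE]
  simp only [Finset.sum_add_distrib, ← Finset.mul_sum, Finset.sum_const, hA, hB, smul_eq_mul]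
  omega

theorem tripleCount_self_le (A : Finset α) (hA : A.card = 4) :
    tripleCount H A A (uncovered P) ≤ 16 * (uncovered P).card := by
  refine (Finset.sum_le_card_nsmul _ _ _ fun x _ => Finset.sum_le_card_nsmul _ _
    (uncovered P).card fun y _ => ?_).trans ?_
  · rw [← Finset.card_filter]
    exact Finset.card_filter_le _ _
  · simp only [hA, smul_eq_mul]
    omega

theorem sum_tripleCount_eq (hP : IsYFamily H P) :
    (∑ u ∈ uncovered P, ∑ x, ∑ y, if {x, y, u} ∈ H then 1 else 0) =
      tripleCount H (uncovered P) (uncovered P) (uncovered P) +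
      2 * ∑ A ∈ P, tripleCount H A (uncovered P) (uncovered P) +
      ∑ A ∈ P, tripleCount H A A (uncovered P) +
      ∑ p ∈ P.offDiag, tripleCount H p.1 p.2 (uncovered P) := by
  have hswap : (∑ u ∈ uncovered P, ∑ x, ∑ y, if {x, y, u} ∈ H then 1 else 0) =
      ∑ x, ∑ y, ∑ u ∈ uncovered P, if {x, y, u} ∈ H then 1 else 0 := by
    rw [Finset.sum_comm]
    exact Finset.sum_congr rfl fun x _ => Finset.sum_comm
  have hcomm : ∀ A : Finset α, tripleCount H (uncovered P) A (uncovered P) =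
      tripleCount H A (uncovered P) (uncovered P) := by
    intro A
    unfold tripleCount
    rw [Finset.sum_comm]
    simp only [Finset.insert_comm]
  have hinner : ∀ X : Finset α,
      (∑ x ∈ X, ∑ y, ∑ u ∈ uncovered P, if {x, y, u} ∈ H then 1 else 0) =
      tripleCount H X (uncovered P) (uncovered P) +
        ∑ B ∈ P, tripleCount H X B (uncovered P) := by
    intro X
    unfold tripleCount
    rw [Finset.sum_comm (s := P), ← Finset.sum_add_distrib]
    exact Finset.sum_congr rfl fun x _ => sum_eq_sum_uncovered_add hP _
  have hdiag : (∑ A ∈ P, ∑ B ∈ P, tripleCount H A B (uncovered P)) =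
      ∑ A ∈ P, tripleCount H A A (uncovered P) +
      ∑ p ∈ P.offDiag, tripleCount H p.1 p.2 (uncovered P) := by
    rw [← Finset.sum_product', ← Finset.diag_union_offDiag,
      Finset.sum_union (Finset.disjoint_diag_offDiag P), Finset.sum_diag]
  rw [hswap, sum_eq_sum_uncovered_add hP, hinner]
  simp only [hinner, Finset.sum_add_distrib, hdiag, hcomm]
  ring

theorem IsMaxYFamily.two_mul_sum_hdeg_le (hH : ∀ e ∈ H, e.card = 3) (hP : IsMaxYFamily H P) :
    2 * ∑ u ∈ uncovered P, hdeg H u ≤ (uncovered P).card ^ 2 +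
      2 * (P.card * ((uncovered P).card ^ 2 + 28 * (uncovered P).card)) +
      P.card * (16 * (uncovered P).card) +
      ((uncovered P).card * ∑ p ∈ P.offDiag, edgeCount (Heavy H P) p.1 p.2 +
        256 * P.card ^ 2) := by
  have h0 : 2 * ∑ u ∈ uncovered P, hdeg H u ≤
      ∑ u ∈ uncovered P, ∑ x, ∑ y, if {x, y, u} ∈ H then 1 else 0 := by
    rw [Finset.mul_sum]
    exact Finset.sum_le_sum fun u _ => two_mul_hdeg_le hH u
  have h1 := hP.tripleCount_uncovered_le hH
  have h2 := Finset.sum_le_card_nsmul P _ _ fun A hA => hP.tripleCount_tile_le hH hA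
  have h3 := Finset.sum_le_card_nsmul P (fun A => tripleCount H A A (uncovered P)) _
    fun A hA => tripleCount_self_le A (hP.isYSet A hA).card_eq
  have h4 : ∑ p ∈ P.offDiag, tripleCount H p.1 p.2 (uncovered P) ≤
      (uncovered P).card * ∑ p ∈ P.offDiag, edgeCount (Heavy H P) p.1 p.2 +
        256 * P.card ^ 2 := by
    refine (Finset.sum_le_sum (g := fun p => (uncovered P).card *
      edgeCount (Heavy H P) p.1 p.2 + 256) fun p hp => ?_).trans ?_
    · have hp' := Finset.mem_offDiag.mp hp
      exact tripleCount_le_edgeCount _ _ (hP.isYSet _ hp'.1).card_eq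
        (hP.isYSet _ hp'.2.1).card_eq
    · rw [Finset.sum_add_distrib, ← Finset.mul_sum, Finset.sum_const, Finset.offDiag_card,
        smul_eq_mul, sq]
      have : P.card * P.card - P.card ≤ P.card * P.card := Nat.sub_le _ _
      nlinarith
  rw [sum_tripleCount_eq hP.toIsYFamily] at h0
  rw [smul_eq_mul] at h2 h3
  linarith

end Counting

open Classical in
/-- The tiles of `P` that do not form a star pair with `A`. -/
noncomputable def nonstar {α : Type*} (g : α → α → Prop) (P : Finset (Finset α))
    (A : Finset α) : Finset (Finset α) :=
  P.filter fun B => A ≠ B ∧ ¬ ∃ c, StarAt g A B c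

/-- The tiles of `P` that fail to form a star pair with more than an eighth of all tiles. -/
noncomputable def badTiles {α : Type*} (g : α → α → Prop) (P : Finset (Finset α)) :
    Finset (Finset α) :=
  P.filter fun A => P.card < 8 * (nonstar g P A).card

theorem mem_nonstar {α : Type*} {P : Finset (Finset α)} {g : α → α → Prop} {A B : Finset α} :
    B ∈ nonstar g P A ↔ B ∈ P ∧ A ≠ B ∧ ¬ ∃ c, StarAt g A B c := by
  simp [nonstar]

section Extraction

variable {α : Type*} [DecidableEq α] {H P : Finset (Finset α)}

open Classical in
theorem card_badTiles_mul_le (g : α → α → Prop) (P : Finset (Finset α)) :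
    (badTiles g P).card * P.card ≤
      8 * (P.offDiag.filter fun p => ¬ ∃ c, StarAt g p.1 p.2 c).card := by
  rw [Finset.card_eq_sum_card_fiberwise (f := Prod.fst) (t := P) (fun p hp =>
    (Finset.mem_offDiag.mp (Finset.mem_filter.mp hp).1).1), Finset.mul_sum]
  refine le_trans ?_ (Finset.sum_le_sum_of_subset (Finset.filter_subset _ _ : badTiles g P ⊆ P))
  rw [← smul_eq_mul]
  refine Finset.card_nsmul_le_sum _ _ _ fun A hA => ?_
  obtain ⟨hAP, hA⟩ := Finset.mem_filter.mp hA
  refine hA.le.trans (Nat.mul_le_mul_left 8 ?_)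
  refine Finset.card_le_card_of_injOn (fun B => (A, B)) (fun B hB => ?_)
    fun B _ C _ h => congrArg Prod.snd h
  obtain ⟨hBP, hAB, hns⟩ := mem_nonstar.mp hB
  exact Finset.mem_coe.mpr (Finset.mem_filter.mpr
    ⟨Finset.mem_filter.mpr ⟨Finset.mem_offDiag.mpr ⟨hAP, hBP, hAB⟩, hns⟩, rfl⟩)

theorem exists_star_of_card_lt {g : α → α → Prop} {I J : Finset (Finset α)} (hI : I ⊆ P)
    (hJ : ∀ A ∈ J, 8 * (nonstar g P A).card ≤ P.card)
    (h : 8 * J.card + J.card * P.card < 8 * I.card) :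
    ∃ B ∈ I, B ∉ J ∧ ∀ A ∈ J, ∃ c, StarAt g A B c := by
  have h1 : (J ∪ J.biUnion (nonstar g P)).card < I.card := by
    have h2 := Finset.card_union_le J (J.biUnion (nonstar g P))
    have h3 := Finset.card_biUnion_le (s := J) (t := nonstar g P)
    have h4 : 8 * ∑ A ∈ J, (nonstar g P A).card ≤ J.card * P.card := by
      rw [Finset.mul_sum, ← smul_eq_mul]
      exact Finset.sum_le_card_nsmul _ _ _ hJ
    omega
  obtain ⟨B, hB, hBJ⟩ := Finset.exists_mem_notMem_of_card_lt_card h1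
  simp only [Finset.mem_union, Finset.mem_biUnion, not_or, not_exists, not_and] at hBJ
  refine ⟨B, hB, hBJ.1, fun A hA => ?_⟩
  by_contra hns
  exact hBJ.2 A hA (mem_nonstar.mpr ⟨hI hB, fun e => hBJ.1 (e ▸ hA), hns⟩)

theorem IsTileGraph.exists_center {g : α → α → Prop} (h : IsTileGraph P g) {A : Finset α}
    (hA : A ∈ P) :
    ∃ c ∈ A, ∀ B ∈ P, A ≠ B → (∃ d, StarAt g A B d) → StarAt g A B c := by
  by_cases hB : ∃ B ∈ P, A ≠ B ∧ ∃ d, StarAt g A B d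
  · obtain ⟨B, hB, hAB, c, hc⟩ := hB
    refine ⟨c, hc.1, fun C hC hAC ⟨d, hd⟩ => ?_⟩
    rwa [h.star_center_unique hA hB hC hAB hAC hc hd]
  · obtain ⟨c, hc⟩ : A.Nonempty := Finset.card_pos.mp (by rw [h.card_eq A hA]; omega)
    exact ⟨c, hc, fun B hB' hAB hd => (hB ⟨B, hB', hAB, hd⟩).elim⟩

theorem IsYFamily.exists_isYTiling (hP : IsYFamily H P) :
    ∃ f : Fin P.card → Fin 4 → α, IsYTiling H P.card f := by
  have hq : ∀ i : Fin P.card, ∃ q : Fin 4 → α, Function.Injective q ∧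
      (∀ j, q j ∈ (P.equivFin.symm i : Finset α)) ∧ {q 0, q 1, q 2} ∈ H ∧
      {q 1, q 2, q 3} ∈ H := by
    intro i
    obtain ⟨a, b, c, d, ⟨h4, h1, h2⟩, ht⟩ := hP.isYSet _ (P.equivFin.symm i).2
    have himage : Finset.univ.image ![a, b, c, d] = {a, b, c, d} := by
      ext x
      simp [Fin.exists_fin_succ, eq_comm]
    refine ⟨![a, b, c, d], ?_, fun j => ?_, h1, h2⟩
    · rw [← Set.injOn_univ, ← Finset.coe_univ, ← Finset.card_image_iff, himage, h4]
      rfl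
    · rw [ht, ← himage]
      exact Finset.mem_image_of_mem _ (Finset.mem_univ j)
  choose f hf hmem h1 h2 using hq
  refine ⟨f, ?_, fun i => ⟨h1 i, h2 i⟩⟩
  rintro ⟨i, j⟩ ⟨i', j'⟩ h
  simp only at h
  obtain rfl : i = i' := by
    by_contra hne
    exact hP.disj _ (P.equivFin.symm i).2 _ (P.equivFin.symm i').2
      (fun e => hne (P.equivFin.symm.injective (Subtype.ext e))) _ (hmem i j) (h ▸ hmem i' j')
  rw [hf i h]

variable [Fintype α]

theorem IsMaxYFamily.exists_free_set [Nonempty α] (hH : ∀ e ∈ H, e.card = 3)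
    (hP : IsMaxYFamily H P) (hbad : 2 * (badTiles (Heavy H P) P).card + 20 < P.card) :
    ∃ S : Finset α, S.card = 3 * (P.card - (badTiles (Heavy H P) P).card) ∧
      ∀ t ⊆ S, ¬ IsYSet H t := by
  have hG := hP.isTileGraph hH
  set I := P \ badTiles (Heavy H P) P with hI
  have hIP : I ⊆ P := Finset.sdiff_subset
  have hIcard : I.card = P.card - (badTiles (Heavy H P) P).card :=
    Finset.card_sdiff_of_subset (Finset.filter_subset _ _)
  have hIstar : ∀ A ∈ I, 8 * (nonstar (Heavy H P) P A).card ≤ P.card := by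
    intro A hA
    obtain ⟨hAP, hA⟩ := Finset.mem_sdiff.mp hA
    by_contra! hlt
    exact hA (Finset.mem_filter.mpr ⟨hAP, hlt⟩)
  have hcenter : ∀ A, ∃ c, A ∈ P → c ∈ A ∧
      ∀ B ∈ P, A ≠ B → (∃ d, StarAt (Heavy H P) A B d) → StarAt (Heavy H P) A B c := by
    intro A
    by_cases hA : A ∈ P
    · obtain ⟨c, hc⟩ := hG.exists_center hA
      exact ⟨c, fun _ => hc⟩
    · exact ⟨Classical.arbitrary α, fun h => (hA h).elim⟩
  choose c hc using hcenter
  refine ⟨I.biUnion fun A => A.erase (c A), ?_, fun t htS ht => ?_⟩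
  · rw [Finset.card_biUnion, Finset.sum_congr rfl (g := fun _ => 3), Finset.sum_const,
      smul_eq_mul, mul_comm, hIcard]
    · intro A hA
      rw [Finset.card_erase_of_mem (hc A (hIP hA)).1, hG.card_eq A (hIP hA)]
    · intro A hA B hB hAB
      refine Finset.disjoint_left.mpr ?_
      exact fun x hxA hxB => hG.disj A (hIP hA) B (hIP hB) hAB x (Finset.mem_of_mem_erase hxA)
        (Finset.mem_of_mem_erase hxB)
  have htI : ∀ x, ∃ A, x ∈ t → A ∈ I ∧ x ∈ A ∧ x ≠ c A := by
    intro x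
    by_cases hx : x ∈ t
    · obtain ⟨A, hA, hxA⟩ := Finset.mem_biUnion.mp (htS hx)
      exact ⟨A, fun _ => ⟨hA, Finset.mem_of_mem_erase hxA, Finset.ne_of_mem_erase hxA⟩⟩
    · exact ⟨∅, fun h => (hx h).elim⟩
  choose T hT using htI
  obtain ⟨J, hTJ, hJI, hJ4⟩ := Finset.exists_subsuperset_card_eq (s := t.image T) (t := I)
    (n := 4) (by
      intro A hA
      obtain ⟨x, hx, rfl⟩ := Finset.mem_image.mp hA
      exact (hT x hx).1) (Finset.card_image_le.trans ht.card_eq.le) (by omega)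
  obtain ⟨B, hB, hBJ, hsB⟩ := exists_star_of_card_lt hIP (fun A hA => hIstar A (hJI hA))
    (by rw [hJ4]; omega)
  have hJB : (insert B J).card = 5 := by rw [Finset.card_insert_of_notMem hBJ, hJ4]
  obtain ⟨C, hC, hCJ, hsC⟩ := exists_star_of_card_lt (Finset.Subset.refl P) (J := insert B J)
    (fun A hA => hIstar A ((Finset.mem_insert.mp hA).elim (fun e => e ▸ hB) fun h => hJI h))
    (by rw [hJB]; omega)
  simp only [Finset.mem_insert, not_or] at hCJ
  have hAP : ∀ i, ((J.equivFinOfCardEq hJ4).symm i : Finset α) ∈ J := fun i => Subtype.property _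
  obtain ⟨b, hb⟩ := hsC B (Finset.mem_insert_self _ _)
  refine hP.not_isYSet_of_stars hH (A := fun i => ((J.equivFinOfCardEq hJ4).symm i : Finset α))
    (c := fun i => c ((J.equivFinOfCardEq hJ4).symm i)) (fun i => hIP (hJI (hAP i))) (hIP hB) hC
    (Subtype.val_injective.comp (Equiv.injective _)) (fun i e => hBJ (e ▸ hAP i))
    (fun i e => hCJ.2 (e ▸ hAP i)) (fun e => hCJ.1 e.symm) (fun i => ?_) (fun i => ?_) hb ht
    fun x hx => ?_
  · exact (hc _ (hIP (hJI (hAP i)))).2 B (hIP hB) (fun e => hBJ (e ▸ hAP i)) (hsB _ (hAP i))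
  · exact (hc _ (hIP (hJI (hAP i)))).2 C hC (fun e => hCJ.2 (e ▸ hAP i))
      (hsC _ (Finset.mem_insert_of_mem (hAP i)))
  · obtain ⟨-, h2, h3⟩ := hT x hx
    refine ⟨J.equivFinOfCardEq hJ4 ⟨T x, hTJ (Finset.mem_image_of_mem T hx)⟩, ?_⟩
    simpa using ⟨h2, h3⟩

theorem exists_isMaxYFamily (H : Finset (Finset α)) : ∃ P, IsMaxYFamily H P := by
  classical
  obtain ⟨P, hP, hmax⟩ := Finset.exists_max_image (Finset.univ.filter fun P => IsYFamily H P)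
    Finset.card ⟨∅, by simp [isYFamily_empty]⟩
  simp only [Finset.mem_filter, Finset.mem_univ, true_and] at hP hmax
  exact ⟨P, hP, hmax⟩

theorem IsYFamily.four_mul_card_add (hP : IsYFamily H P) :
    4 * P.card + (uncovered P).card = Fintype.card α := by
  have h := sum_eq_sum_uncovered_add hP fun _ => 1
  have h4 : ∑ A ∈ P, A.card = 4 * P.card := by
    rw [Finset.sum_congr rfl fun A hA => (hP.isYSet A hA).card_eq, Finset.sum_const,
      smul_eq_mul, mul_comm]
  simp only [Finset.sum_const, smul_eq_mul, mul_one, h4, Finset.card_univ] at h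
  omega

end Extraction

theorem tile_count_numerics {γ n m u D b N : ℝ} (hγ : 0 < γ) (hγ' : γ < 1 / 2048) (hm : 0 ≤ m)
    (hb : 0 ≤ b) (hn : n = 4 * m + u) (hu : 2 ^ 19 < γ * u)
    (hdeg : 2 * (u * ((7 / 16 - γ) * (n * (n - 1) / 2))) ≤ u ^ 2 +
      2 * (m * (u ^ 2 + 28 * u)) + m * (16 * u) + (u * D + 256 * m ^ 2))
    (hlow : -(4 * m) ≤ 7 * (m * m - m) - D)
    (hN : N ≤ 5 * (7 * (m * m - m) - D) + 16 * m) (hbN : b * m ≤ 8 * N) :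
    (1 - 2048 * γ) * (3 / 4) * n ≤ 3 * (m - b) ∧ 2 * b + 20 < m := by
  have hu0 : 0 < u := pos_of_mul_pos_right (by linarith) hγ.le
  have hn0 : 0 < n := by linarith
  have hun : u ≤ n := by linarith
  have hm4 : m ≤ n / 4 := by linarith
  have hγn : 2 ^ 19 < γ * n := hu.trans_le (by gcongr)
  have hn30 : 2 ^ 30 < n := by nlinarith
  have hlin : 2 ^ 19 * n ≤ γ * n ^ 2 := by nlinarith
  have hm2 : 256 * m ^ 2 ≤ u * (γ * m ^ 2 / 2048) := by nlinarith [sq_nonneg m]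
  have hdiv : (7 / 16 - γ) * (n * (n - 1)) ≤ u + 2 * m * (u + 28) + 16 * m + D +
      γ * m ^ 2 / 2048 := by
    refine le_of_mul_le_mul_left ?_ hu0
    linarith
  have hmsq : γ * m ^ 2 ≤ γ * n ^ 2 / 16 := by
    have : m ^ 2 ≤ (n / 4) ^ 2 := by gcongr
    nlinarith
  have hmain : (7 * (m * m - m) - D) + 3 / 2 * (m * u) + 7 / 16 * u ^ 2 ≤
      1001 / 1000 * (γ * n ^ 2) := by
    have e : 7 / 16 * (n * n) = 7 * (m * m) + 7 / 2 * (m * u) + 7 / 16 * u ^ 2 := by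
      rw [hn]; ring
    have h0 : 0 ≤ γ * n := by positivity
    have e' : (7 / 16 - γ) * (n * (n - 1)) =
        7 / 16 * (n * n) - 7 / 16 * n - γ * n ^ 2 + γ * n := by ring
    linarith
  have hmu : 3 / 2 * (m * u) + 7 / 16 * u ^ 2 ≤ 1002 / 1000 * (γ * n ^ 2) := by linarith
  have hmu0 : 0 ≤ m * u := by positivity
  have hγn2 : γ * n ^ 2 ≤ 1 / 2048 * n ^ 2 := by gcongr
  have husmall : u ≤ 4 / 100 * n := by
    refine le_of_sq_le_sq ?_ (by positivity)
    nlinarith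
  have hmbig : 24 / 100 * n ≤ m := by linarith
  have hu3 : u ≤ 3 * (γ * n) := by
    refine le_of_mul_le_mul_left (?_ : n * u ≤ n * (3 * (γ * n))) hn0
    nlinarith [sq_nonneg u, mul_le_mul_of_nonneg_right hmbig hu0.le]
  have hNS : 8 * N ≤ 402 / 10 * (γ * n ^ 2) := by nlinarith [sq_nonneg u]
  have hb168 : b ≤ 168 * (γ * n) := by
    refine le_of_mul_le_mul_left (?_ : n * b ≤ n * (168 * (γ * n))) hn0
    nlinarith [mul_le_mul_of_nonneg_left hmbig hb]
  have hγn1 : γ * n ≤ 1 / 2048 * n := by gcongr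
  constructor <;> linarith

/-- Under minimum vertex degree `(7/16 - γ) C(n,2)`, either there is a `𝒴`-tiling covering
all but at most `2¹⁹/γ` vertices, or there is a `𝒴`-free vertex set of size at least
`(1 - 2¹¹γ)(3/4)n`. -/
theorem stmt_13 (γ : ℝ) (hγ : 0 < γ) :
    ∃ n₀ : ℕ, ∀ n : ℕ, n > n₀ →
      ∀ H : Finset (Finset (Fin n)), (∀ e ∈ H, e.card = 3) →
      (∀ x : Fin n, (7 / 16 - γ) * (n.choose 2 : ℝ) ≤ (hdeg H x : ℝ)) →
      (∃ (m : ℕ) (f : Fin m → Fin 4 → Fin n), IsYTiling H m f ∧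
        (n : ℝ) - 4 * m ≤ 2 ^ 19 / γ) ∨
      (∃ S : Finset (Fin n), (1 - 2 ^ 11 * γ) * (3 / 4) * (n : ℝ) ≤ (S.card : ℝ) ∧
        ¬ ∃ a b c d : Fin n, a ∈ S ∧ b ∈ S ∧ c ∈ S ∧ d ∈ S ∧ YCopy H a b c d) := by
  refine ⟨0, fun n hn H hH hdegree => ?_⟩
  by_cases hγ' : 1 / 2048 ≤ γ
  · refine Or.inr ⟨∅, ?_, by simp⟩
    have : (0 : ℝ) ≤ n := Nat.cast_nonneg n
    rw [Finset.card_empty, Nat.cast_zero]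
    exact mul_nonpos_of_nonpos_of_nonneg (by linarith) this
  push Not at hγ'
  have : Nonempty (Fin n) := ⟨⟨0, hn⟩⟩
  obtain ⟨P, hP⟩ := exists_isMaxYFamily H
  have hcard := hP.four_mul_card_add
  rw [Fintype.card_fin] at hcard
  have hn' : (n : ℝ) = 4 * P.card + (uncovered P).card := by exact_mod_cast hcard.symm
  by_cases hu : ((uncovered P).card : ℝ) ≤ 2 ^ 19 / γ
  · obtain ⟨f, hf⟩ := hP.exists_isYTiling
    exact Or.inl ⟨P.card, f, hf, by linarith⟩
  push Not at hu
  rw [div_lt_iff₀' hγ] at hu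
  right
  have hG := hP.isTileGraph hH
  have hoff : ∑ p ∈ P.offDiag, (7 - (edgeCount (Heavy H P) p.1 p.2 : ℤ)) =
      7 * ((P.card : ℤ) * P.card - P.card) -
        ((∑ p ∈ P.offDiag, edgeCount (Heavy H P) p.1 p.2 : ℕ) : ℤ) := by
    rw [Finset.sum_sub_distrib, Finset.sum_const, Finset.offDiag_card, nsmul_eq_mul,
      Nat.cast_sub (Nat.le_mul_self _)]
    push_cast
    ring
  have hdom := hG.dominating_count_le
  have hnon := hG.nonstar_count_le
  rw [hoff] at hdom hnon
  have hdom0 := (Finset.sum_nonneg fun p _ => by split_ifs <;> norm_num).trans hdom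
  have hsum : ((uncovered P).card : ℝ) * ((7 / 16 - γ) * (n * (n - 1) / 2)) ≤
      ∑ u ∈ uncovered P, (hdeg H u : ℝ) := by
    rw [← nsmul_eq_mul, ← Nat.cast_choose_two]
    exact Finset.card_nsmul_le_sum _ _ _ fun x _ => hdegree x
  have hup := (Nat.cast_le (α := ℝ)).mpr (hP.two_mul_sum_hdeg_le hH)
  push_cast at hup
  obtain ⟨N, hN, hbN⟩ : ∃ N : ℕ, (N : ℤ) ≤ 5 * (7 * ((P.card : ℤ) * P.card - P.card) -
      ((∑ p ∈ P.offDiag, edgeCount (Heavy H P) p.1 p.2 : ℕ) : ℤ)) + 16 * P.card ∧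
      (badTiles (Heavy H P) P).card * P.card ≤ 8 * N := ⟨_, hnon, card_badTiles_mul_le _ _⟩
  obtain ⟨h1, h2⟩ := tile_count_numerics (b := ((badTiles (Heavy H P) P).card : ℝ)) hγ hγ'
    (Nat.cast_nonneg P.card) (Nat.cast_nonneg _) hn' hu
    (D := ((∑ p ∈ P.offDiag, edgeCount (Heavy H P) p.1 p.2 : ℕ) : ℝ)) (by push_cast; linarith)
    (by
      have : -(4 * (P.card : ℤ)) ≤ 7 * ((P.card : ℤ) * P.card - P.card) -
        ((∑ p ∈ P.offDiag, edgeCount (Heavy H P) p.1 p.2 : ℕ) : ℤ) := by linarith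
      exact_mod_cast this) (N := N) (by exact_mod_cast hN)
    (by exact_mod_cast hbN)
  have h2' : 2 * (badTiles (Heavy H P) P).card + 20 < P.card := by exact_mod_cast h2
  obtain ⟨S, hS, hfree⟩ := hP.exists_free_set hH h2'
  refine ⟨S, ?_, ?_⟩
  · rw [hS, Nat.cast_mul, Nat.cast_sub (by omega)]
    norm_num at h1 ⊢
    exact h1
  · rintro ⟨a, b, c, d, ha, hb, hc, hd, h⟩
    refine hfree {a, b, c, d} ?_ ⟨a, b, c, d, h, rfl⟩
    intro x hx
    simp only [Finset.mem_insert, Finset.mem_singleton] at hx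
    rcases hx with rfl | rfl | rfl | rfl <;> assumption
end
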